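/- arXiv:1909.01833 — 3 statements merged into one kernel-verified Lean document; each statement's English description precedes it below -/
import Mathlib

section
/- The ternary quadratic form x² + 2y² + 2z² is strongly s-regular: for every positive integer n = n₁n₂ with n₁ a power of 2 and n₂ odd, r(n₁²n₂², f) = r(n₁², f) · ∏_{p | n₂} h_p(ord_p(n₂)). -/
open Finset

/-- The value of the diagonal ternary form `a x² + b y² + c z²`. -/
def tVal (a b c : ℤ) (v : ℤ × ℤ × ℤ) : ℤ :=
  a * v.1 ^ 2 + b * v.2.1 ^ 2 + c * v.2.2 ^ 2

/-- The number of representations of `n` by the diagonal ternary form `a x² + b y² + c z²`. -/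
noncomputable def tRep (a b c n : ℤ) : ℕ :=
  Set.ncard {v : ℤ × ℤ × ℤ | tVal a b c v = n}

/-- The local factor `h_p(μ)` for a diagonal ternary form `a x² + b y² + c z²`. -/
def tHp (a b c : ℤ) (p : ℕ) (μ : ℕ) : ℤ :=
  ((p : ℤ) ^ (μ + 1) - 1) / ((p : ℤ) - 1) -
    jacobiSym (-(a * b * c)) p * (((p : ℤ) ^ μ - 1) / ((p : ℤ) - 1))

/-- The number of representations of `n` as an ordered sum of two integer squares. -/
noncomputable def sqAddSqCount (n : ℕ) : ℕ :=
  Set.ncard {v : ℤ × ℤ | v.1 ^ 2 + v.2 ^ 2 = (n : ℤ)}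

/-- The sum of the nontrivial character mod 4 over the divisors of `n`. -/
def chiDivisorSum (n : ℕ) : ℤ := ∑ d ∈ n.divisors, ZMod.χ₄ (d : ZMod 4)

theorem finite_sq_add_sq (n : ℤ) : {v : ℤ × ℤ | v.1 ^ 2 + v.2 ^ 2 = n}.Finite := by
  refine ((Set.finite_Icc (-n) n).prod (Set.finite_Icc (-n) n)).subset ?_
  rintro ⟨x, y⟩ h
  simp only [Set.mem_ofPred_eq] at h
  simp only [Set.mem_prod, Set.mem_Icc]
  refine ⟨⟨?_, ?_⟩, ?_, ?_⟩ <;>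
    nlinarith [Int.le_self_sq x, Int.le_self_sq y, Int.le_self_sq (-x), Int.le_self_sq (-y),
      sq_nonneg x, sq_nonneg y]

theorem sqAddSqCount_zero : sqAddSqCount 0 = 1 := by
  rw [sqAddSqCount, Set.ncard_eq_one]
  refine ⟨(0, 0), ?_⟩
  ext ⟨x, y⟩
  simp only [Set.mem_ofPred_eq, Set.mem_singleton_iff, Prod.mk.injEq, Nat.cast_zero]
  constructor
  · intro h
    constructor <;> nlinarith [sq_nonneg x, sq_nonneg y]
  · rintro ⟨rfl, rfl⟩
    norm_num

theorem sqAddSqCount_one : sqAddSqCount 1 = 4 := by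
  have : {v : ℤ × ℤ | v.1 ^ 2 + v.2 ^ 2 = ((1 : ℕ) : ℤ)} =
      (({(1, 0), (-1, 0), (0, 1), (0, -1)} : Finset (ℤ × ℤ)) : Set (ℤ × ℤ)) := by
    ext ⟨x, y⟩
    simp only [Set.mem_ofPred_eq, Nat.cast_one, Finset.coe_insert, Finset.coe_singleton,
      Set.mem_insert_iff, Set.mem_singleton_iff, Prod.mk.injEq]
    constructor
    · intro h
      have h1 : x ≤ 1 := by nlinarith [sq_nonneg y]
      have h2 : -1 ≤ x := by nlinarith [sq_nonneg y]
      have h3 : y ≤ 1 := by nlinarith [sq_nonneg x]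
      have h4 : -1 ≤ y := by nlinarith [sq_nonneg x]
      interval_cases x <;> interval_cases y <;> simp_all
    · rintro (⟨rfl, rfl⟩ | ⟨rfl, rfl⟩ | ⟨rfl, rfl⟩ | ⟨rfl, rfl⟩) <;> norm_num
  rw [sqAddSqCount, this, Set.ncard_coe_finset]
  decide

/-- The representations of `p * n` (with `p = a ^ 2 + b ^ 2`) divisible by `a + b i` correspond to
the representations of `n`. -/
theorem ncard_sq_add_sq_dvd {p : ℕ} (hp : p.Prime) {a b : ℤ} (hab : a ^ 2 + b ^ 2 = p) (n : ℕ) :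
    Set.ncard {v : ℤ × ℤ | v.1 ^ 2 + v.2 ^ 2 = ((p * n : ℕ) : ℤ) ∧
      (p : ℤ) ∣ a * v.1 + b * v.2} = sqAddSqCount n := by
  have hp0 : (p : ℤ) ≠ 0 := by exact_mod_cast hp.ne_zero
  have hpz : Prime (p : ℤ) := Nat.prime_iff_prime_int.mp hp
  have hinj : Function.Injective (fun v : ℤ × ℤ => (a * v.1 + b * v.2, b * v.1 - a * v.2)) := by
    rintro ⟨x, y⟩ ⟨z, w⟩ h
    simp only [Prod.mk.injEq] at h ⊢
    obtain ⟨h1, h2⟩ := h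
    constructor
    · apply mul_left_cancel₀ hp0
      rw [← hab]
      linear_combination a * h1 + b * h2
    · apply mul_left_cancel₀ hp0
      rw [← hab]
      linear_combination b * h1 - a * h2
  rw [sqAddSqCount,
    ← Set.ncard_image_of_injective {v : ℤ × ℤ | v.1 ^ 2 + v.2 ^ 2 = (n : ℤ)} hinj]
  congr 1
  ext ⟨x, y⟩
  simp only [Set.mem_ofPred_eq, Set.mem_image, Prod.mk.injEq, Prod.exists]
  push_cast
  constructor
  · rintro ⟨h, u, hu⟩
    have h2 : (p : ℤ) ∣ (b * x - a * y) ^ 2 := by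
      refine ⟨p * n - p * u ^ 2, ?_⟩
      linear_combination (a ^ 2 + b ^ 2) * h + p * n * hab - (a * x + b * y + p * u) * hu
    obtain ⟨w, hw⟩ := hpz.dvd_of_dvd_pow h2
    refine ⟨u, w, ?_, ?_, ?_⟩
    · apply mul_left_cancel₀ (pow_ne_zero 2 hp0)
      linear_combination (a ^ 2 + b ^ 2) * h + p * n * hab - (a * x + b * y + p * u) * hu
        - (b * x - a * y + p * w) * hw
    · apply mul_left_cancel₀ hp0
      linear_combination -a * hu - b * hw + x * hab
    · apply mul_left_cancel₀ hp0
      linear_combination -b * hu + a * hw + y * hab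
  · rintro ⟨u, w, h, rfl, rfl⟩
    refine ⟨?_, u, ?_⟩
    · linear_combination (a ^ 2 + b ^ 2) * h + n * hab
    · linear_combination u * hab

/-- The representations of `p * n` by vectors divisible by `p`. -/
theorem ncard_sq_add_sq_dvd_dvd {p : ℕ} (hp : p.Prime) (n : ℕ) :
    Set.ncard {v : ℤ × ℤ | v.1 ^ 2 + v.2 ^ 2 = ((p * n : ℕ) : ℤ) ∧
      (p : ℤ) ∣ v.1 ∧ (p : ℤ) ∣ v.2} = if p ∣ n then sqAddSqCount (n / p) else 0 := by
  have hp0 : (p : ℤ) ≠ 0 := by exact_mod_cast hp.ne_zero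
  split_ifs with h
  · obtain ⟨m, rfl⟩ := h
    have hinj : Function.Injective (fun v : ℤ × ℤ => ((p : ℤ) * v.1, (p : ℤ) * v.2)) := by
      rintro ⟨x, y⟩ ⟨z, w⟩ h
      simpa [hp.ne_zero] using h
    rw [Nat.mul_div_cancel_left _ hp.pos, sqAddSqCount,
      ← Set.ncard_image_of_injective {v : ℤ × ℤ | v.1 ^ 2 + v.2 ^ 2 = (m : ℤ)} hinj]
    congr 1
    ext ⟨x, y⟩
    simp only [Set.mem_ofPred_eq, Set.mem_image, Prod.mk.injEq, Prod.exists]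
    push_cast
    constructor
    · rintro ⟨h, ⟨u, rfl⟩, ⟨w, rfl⟩⟩
      refine ⟨u, w, ?_, rfl, rfl⟩
      apply mul_left_cancel₀ (pow_ne_zero 2 hp0)
      linear_combination h
    · rintro ⟨u, w, h, rfl, rfl⟩
      exact ⟨by linear_combination (p : ℤ) ^ 2 * h, dvd_mul_right _ _, dvd_mul_right _ _⟩
  · rw [Set.ncard_eq_zero ((finite_sq_add_sq _).subset fun v hv => hv.1),
      Set.eq_empty_iff_forall_notMem]
    rintro ⟨x, y⟩ ⟨h1, ⟨u, hu⟩, ⟨w, hw⟩⟩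
    simp only at h1 hu hw
    subst hu hw
    apply h
    have : (p : ℤ) ∣ n := by
      refine ⟨u ^ 2 + w ^ 2, ?_⟩
      apply mul_left_cancel₀ hp0
      push_cast at h1
      linear_combination -h1
    exact_mod_cast this

theorem sqAddSqCount_two_mul (n : ℕ) : sqAddSqCount (2 * n) = sqAddSqCount n := by
  rw [← ncard_sq_add_sq_dvd Nat.prime_two (a := 1) (b := 1) (by norm_num) n, sqAddSqCount]
  congr 1
  ext ⟨x, y⟩
  simp only [Set.mem_ofPred_eq]
  refine ⟨fun h => ⟨h, ?_⟩, fun h => h.1⟩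
  have h2 : (2 : ℤ) ∣ (x + y) ^ 2 := ⟨n + x * y, by push_cast at h; linear_combination h⟩
  simpa using Int.prime_two.dvd_of_dvd_pow h2

theorem dvd_and_dvd_of_dvd_sq_add_sq {p : ℕ} (hp : p.Prime) (h3 : p % 4 = 3) {x y : ℤ}
    (h : (p : ℤ) ∣ x ^ 2 + y ^ 2) : (p : ℤ) ∣ x ∧ (p : ℤ) ∣ y := by
  have := Fact.mk hp
  have hz : (x : ZMod p) ^ 2 + (y : ZMod p) ^ 2 = 0 := by
    have := (ZMod.intCast_zmod_eq_zero_iff_dvd (x ^ 2 + y ^ 2) p).2 h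
    exact_mod_cast this
  rw [← ZMod.intCast_zmod_eq_zero_iff_dvd, ← ZMod.intCast_zmod_eq_zero_iff_dvd]
  by_cases hy : (y : ZMod p) = 0
  · refine ⟨?_, hy⟩
    simpa [hy] using hz
  · exact absurd h3 (ZMod.mod_four_ne_three_of_sq_eq_neg_sq' hy (eq_neg_of_add_eq_zero_left hz))

theorem sqAddSqCount_prime_mul_of_mod_four_eq_three {p : ℕ} (hp : p.Prime) (h3 : p % 4 = 3)
    (n : ℕ) : sqAddSqCount (p * n) = if p ∣ n then sqAddSqCount (n / p) else 0 := by
  rw [← ncard_sq_add_sq_dvd_dvd hp, sqAddSqCount]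
  congr 1
  ext ⟨x, y⟩
  simp only [Set.mem_ofPred_eq]
  refine ⟨fun h => ⟨h, dvd_and_dvd_of_dvd_sq_add_sq hp h3 ?_⟩, fun h => h.1⟩
  rw [h]
  push_cast
  exact dvd_mul_right _ _

theorem sqAddSqCount_prime_mul_of_mod_four_eq_one {p : ℕ} (hp : p.Prime) (h1 : p % 4 = 1)
    (n : ℕ) : sqAddSqCount (p * n) + (if p ∣ n then sqAddSqCount (n / p) else 0) =
      2 * sqAddSqCount n := by
  have := Fact.mk hp
  obtain ⟨a, b, hab⟩ := Nat.Prime.sq_add_sq (p := p) (by omega)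
  have hab1 : (a : ℤ) ^ 2 + (b : ℤ) ^ 2 = p := by exact_mod_cast hab
  have hab2 : (a : ℤ) ^ 2 + (-b : ℤ) ^ 2 = p := by linear_combination hab1
  have hpz : Prime (p : ℤ) := Nat.prime_iff_prime_int.mp hp
  have hpa : ¬ (p : ℤ) ∣ a := by
    intro h
    have h' : p ∣ a := by exact_mod_cast h
    have hb : p ∣ b ^ 2 := (Nat.dvd_add_right (h'.pow two_ne_zero)).1 (hab ▸ dvd_rfl)
    have hb' := hp.dvd_of_dvd_pow hb
    have : p ^ 2 ∣ p := by
      conv_rhs => rw [← hab]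
      exact dvd_add (pow_dvd_pow_of_dvd h' 2) (pow_dvd_pow_of_dvd hb' 2)
    have h2 := Nat.le_of_dvd hp.pos this
    nlinarith [hp.two_le]
  have hp2 : ¬ (p : ℤ) ∣ 2 := by
    intro h
    have := Nat.le_of_dvd two_pos (by exact_mod_cast h : p ∣ 2)
    have := hp.two_le
    omega
  have hfin := finite_sq_add_sq ((p * n : ℕ) : ℤ)
  have key := Set.ncard_union_add_ncard_inter
    {v : ℤ × ℤ | v.1 ^ 2 + v.2 ^ 2 = ((p * n : ℕ) : ℤ) ∧ (p : ℤ) ∣ a * v.1 + b * v.2}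
    {v : ℤ × ℤ | v.1 ^ 2 + v.2 ^ 2 = ((p * n : ℕ) : ℤ) ∧ (p : ℤ) ∣ a * v.1 + (-b) * v.2}
    (hfin.subset fun v hv => hv.1) (hfin.subset fun v hv => hv.1)
  rw [ncard_sq_add_sq_dvd hp hab1, ncard_sq_add_sq_dvd hp hab2, ← two_mul] at key
  rw [← key, ← ncard_sq_add_sq_dvd_dvd hp, sqAddSqCount]
  congr 2
  · ext ⟨x, y⟩
    simp only [Set.mem_ofPred_eq, Set.mem_union]
    constructor
    · intro h
      have : (p : ℤ) ∣ (a * x + b * y) * (a * x + (-b) * y) := by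
        refine ⟨a ^ 2 * n - y ^ 2, ?_⟩
        push_cast at h
        linear_combination (a : ℤ) ^ 2 * h - y ^ 2 * hab1
      rcases hpz.dvd_or_dvd this with h' | h'
      · exact Or.inl ⟨h, h'⟩
      · exact Or.inr ⟨h, h'⟩
    · rintro (h | h) <;> exact h.1
  · ext ⟨x, y⟩
    simp only [Set.mem_ofPred_eq, Set.mem_inter_iff]
    constructor
    · rintro ⟨h, hx, hy⟩
      exact ⟨⟨h, dvd_add (hx.mul_left _) (hy.mul_left _)⟩,
        ⟨h, dvd_add (hx.mul_left _) (hy.mul_left _)⟩⟩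
    · rintro ⟨⟨h, h1⟩, ⟨-, h2⟩⟩
      have hx : (p : ℤ) ∣ 2 * (a * x) := by
        have := dvd_add h1 h2
        ring_nf at this ⊢
        exact this
      have hx' : (p : ℤ) ∣ x :=
        (hpz.dvd_or_dvd ((hpz.dvd_or_dvd hx).resolve_left hp2)).resolve_left hpa
      refine ⟨h, hx', ?_⟩
      have : (p : ℤ) ∣ y ^ 2 := by
        have e : y ^ 2 = p * n - x * x := by push_cast at h; linear_combination h
        rw [e]
        exact dvd_sub (dvd_mul_right _ _) (hx'.mul_left _)
      exact hpz.dvd_of_dvd_pow this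

theorem sqAddSqCount_prime_mul {p : ℕ} (hp : p.Prime) (n : ℕ) :
    (sqAddSqCount (p * n) : ℤ) = (1 + ZMod.χ₄ (p : ZMod 4)) * sqAddSqCount n -
      ZMod.χ₄ (p : ZMod 4) * (if p ∣ n then (sqAddSqCount (n / p) : ℤ) else 0) := by
  rcases hp.eq_two_or_odd with rfl | hodd
  · have : ZMod.χ₄ ((2 : ℕ) : ZMod 4) = 0 := by decide
    rw [this, sqAddSqCount_two_mul]
    ring
  · have h4 : p % 4 = 1 ∨ p % 4 = 3 := by omega
    rcases h4 with h | h
    · rw [ZMod.χ₄_nat_one_mod_four h]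
      have := congrArg (Nat.cast (R := ℤ)) (sqAddSqCount_prime_mul_of_mod_four_eq_one hp h n)
      rw [Nat.cast_add, Nat.cast_ite, Nat.cast_mul, Nat.cast_zero, Nat.cast_two] at this
      linear_combination this
    · rw [ZMod.χ₄_nat_three_mod_four h, sqAddSqCount_prime_mul_of_mod_four_eq_three hp h]
      push_cast
      ring

theorem chiDivisorSum_prime_mul {p : ℕ} (hp : p.Prime) {n : ℕ} (hn : n ≠ 0) :
    chiDivisorSum (p * n) = (1 + ZMod.χ₄ (p : ZMod 4)) * chiDivisorSum n -
      ZMod.χ₄ (p : ZMod 4) * (if p ∣ n then chiDivisorSum (n / p) else 0) := by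
  have hinj : Function.Injective (fun d : ℕ => p * d) := fun _ _ h => Nat.eq_of_mul_eq_mul_left hp.pos h
  have hU : (p * n).divisors = n.divisors ∪ n.divisors.image (p * ·) := by
    ext d
    simp only [Nat.mem_divisors, Finset.mem_union, Finset.mem_image, ne_eq, hn, not_false_eq_true,
      and_true, mul_eq_zero, hp.ne_zero, or_self]
    constructor
    · intro h
      by_cases hpd : p ∣ d
      · obtain ⟨e, rfl⟩ := hpd
        exact Or.inr ⟨e, Nat.dvd_of_mul_dvd_mul_left hp.pos h, rfl⟩
      · exact Or.inl (((hp.coprime_iff_not_dvd.2 hpd).symm).dvd_of_dvd_mul_left h)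
    · rintro (h | ⟨e, h, rfl⟩)
      · exact h.mul_left _
      · exact mul_dvd_mul_left _ h
  have hI : ∑ d ∈ n.divisors ∩ n.divisors.image (p * ·), ZMod.χ₄ (d : ZMod 4) =
      ZMod.χ₄ (p : ZMod 4) * (if p ∣ n then chiDivisorSum (n / p) else 0) := by
    split_ifs with h
    · obtain ⟨m, rfl⟩ := h
      have hm : m ≠ 0 := right_ne_zero_of_mul hn
      have : (p * m).divisors ∩ (p * m).divisors.image (p * ·) = m.divisors.image (p * ·) := by
        ext d
        simp only [Finset.mem_inter, Nat.mem_divisors, Finset.mem_image, ne_eq, hn, hm,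
          not_false_eq_true, and_true]
        constructor
        · rintro ⟨h, e, -, rfl⟩
          exact ⟨e, Nat.dvd_of_mul_dvd_mul_left hp.pos h, rfl⟩
        · rintro ⟨e, h, rfl⟩
          exact ⟨mul_dvd_mul_left _ h, e, h.mul_left _, rfl⟩
      rw [this, Finset.sum_image hinj.injOn, Nat.mul_div_cancel_left _ hp.pos, chiDivisorSum,
        Finset.mul_sum]
      simp only [Nat.cast_mul, map_mul]
    · rw [mul_zero]
      apply Finset.sum_eq_zero
      intro d hd
      simp only [Finset.mem_inter, Nat.mem_divisors, Finset.mem_image] at hd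
      obtain ⟨⟨hd, -⟩, e, -, rfl⟩ := hd
      exact absurd ((dvd_mul_right _ _).trans hd) h
  have key := Finset.sum_union_inter (s₁ := n.divisors) (s₂ := n.divisors.image (p * ·))
    (f := fun d : ℕ => ZMod.χ₄ (d : ZMod 4))
  rw [← hU, hI, Finset.sum_image hinj.injOn] at key
  have h2 : ∑ d ∈ n.divisors, ZMod.χ₄ ((p * d : ℕ) : ZMod 4) =
      ZMod.χ₄ (p : ZMod 4) * chiDivisorSum n := by
    rw [chiDivisorSum, Finset.mul_sum]
    simp only [Nat.cast_mul, map_mul]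
  rw [h2] at key
  rw [chiDivisorSum]
  rw [show ∑ d ∈ n.divisors, ZMod.χ₄ (d : ZMod 4) = chiDivisorSum n from rfl] at key
  linear_combination key

/-- Jacobi's two-square theorem. -/
theorem sqAddSqCount_eq (n : ℕ) (hn : n ≠ 0) : (sqAddSqCount n : ℤ) = 4 * chiDivisorSum n := by
  induction n using Nat.strong_induction_on with
  | _ n ih =>
    rcases eq_or_ne n 1 with rfl | h1
    · rw [sqAddSqCount_one]
      simp [chiDivisorSum]
    · obtain ⟨p, hp, m, rfl⟩ := Nat.exists_prime_and_dvd h1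
      have hm : m ≠ 0 := right_ne_zero_of_mul hn
      have hlt : m < p * m := by nlinarith [hp.two_le, Nat.pos_of_ne_zero hm]
      rw [sqAddSqCount_prime_mul hp, chiDivisorSum_prime_mul hp hm, ih m hlt hm]
      split_ifs with h
      · rw [ih (m / p) ((Nat.div_le_self _ _).trans_lt hlt)
          (Nat.div_pos (Nat.le_of_dvd (Nat.pos_of_ne_zero hm) h) hp.pos).ne']
        ring
      · ring

/-- The Hecke relation for `chiDivisorSum`. -/
theorem chiDivisorSum_mul_chiDivisorSum {a b : ℕ} (ha : a ≠ 0) (hb : b ≠ 0) :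
    chiDivisorSum a * chiDivisorSum b =
      ∑ d ∈ (a.gcd b).divisors, ZMod.χ₄ (d : ZMod 4) * chiDivisorSum (a / d * (b / d)) := by
  simp only [chiDivisorSum]
  rw [Finset.sum_mul_sum]
  simp only [Finset.mul_sum]
  rw [← Finset.sum_product', Finset.sum_sigma']
  refine Finset.sum_bij'
    (fun v _ => (⟨Nat.gcd (a / v.1) v.2, v.1 * (v.2 / Nat.gcd (a / v.1) v.2)⟩ : (_ : ℕ) × ℕ))
    (fun w _ => (Nat.gcd (a / w.1) w.2, w.2 / Nat.gcd (a / w.1) w.2 * w.1)) ?_ ?_ ?_ ?_ ?_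
  · rintro ⟨x, y⟩ h
    simp only [Finset.mem_product, Nat.mem_divisors, Finset.mem_sigma] at h ⊢
    obtain ⟨⟨⟨u, rfl⟩, -⟩, hy, -⟩ := h
    have hx : 0 < x := Nat.pos_of_ne_zero (left_ne_zero_of_mul ha)
    have hu : 0 < u := Nat.pos_of_ne_zero (right_ne_zero_of_mul ha)
    have hg : 0 < u.gcd y := Nat.gcd_pos_of_pos_left _ hu
    rw [Nat.mul_div_cancel_left _ hx]
    have h1 : u.gcd y ∣ x * u := (Nat.gcd_dvd_left _ _).mul_left _
    have h2 : u.gcd y ∣ b := (Nat.gcd_dvd_right _ _).trans hy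
    refine ⟨⟨Nat.dvd_gcd h1 h2, (Nat.gcd_pos_of_pos_right _ (Nat.pos_of_ne_zero hb)).ne'⟩,
      mul_dvd_mul ?_ (Nat.div_dvd_div (Nat.gcd_dvd_right _ _) hy), ?_⟩
    · rw [Nat.mul_div_assoc _ (Nat.gcd_dvd_left _ _)]
      exact dvd_mul_right _ _
    · exact mul_ne_zero (Nat.div_pos (Nat.le_of_dvd (Nat.pos_of_ne_zero ha) h1) hg).ne'
        (Nat.div_pos (Nat.le_of_dvd (Nat.pos_of_ne_zero hb) h2) hg).ne'
  · rintro ⟨d, e⟩ h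
    simp only [Finset.mem_product, Nat.mem_divisors, Finset.mem_sigma] at h ⊢
    obtain ⟨⟨hd, -⟩, he, -⟩ := h
    obtain ⟨u, rfl⟩ := hd.trans (Nat.gcd_dvd_left _ _)
    obtain ⟨w, rfl⟩ := hd.trans (Nat.gcd_dvd_right _ _)
    have hd0 : 0 < d := Nat.pos_of_ne_zero (left_ne_zero_of_mul ha)
    have hu : 0 < u := Nat.pos_of_ne_zero (right_ne_zero_of_mul ha)
    rw [Nat.mul_div_cancel_left _ hd0, Nat.mul_div_cancel_left _ hd0] at he
    rw [Nat.mul_div_cancel_left _ hd0]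
    refine ⟨⟨(Nat.gcd_dvd_left _ _).mul_left _, ha⟩, ?_, hb⟩
    rw [mul_comm d w]
    apply mul_dvd_mul_right
    have hg : 0 < u.gcd e := Nat.gcd_pos_of_pos_left _ hu
    have hc : Nat.Coprime (e / u.gcd e) (u / u.gcd e) := (Nat.coprime_div_gcd_div_gcd hg).symm
    apply hc.dvd_of_dvd_mul_left
    have h3 : u * w / u.gcd e = u / u.gcd e * w := by
      rw [Nat.div_mul_right_comm (Nat.gcd_dvd_left _ _)]
    rw [← h3]
    exact Nat.div_dvd_div (Nat.gcd_dvd_right _ _) he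
  · rintro ⟨x, y⟩ h
    simp only [Finset.mem_product, Nat.mem_divisors] at h
    obtain ⟨⟨⟨u, rfl⟩, -⟩, hy, -⟩ := h
    have hx : 0 < x := Nat.pos_of_ne_zero (left_ne_zero_of_mul ha)
    have hu : 0 < u := Nat.pos_of_ne_zero (right_ne_zero_of_mul ha)
    have hg : 0 < u.gcd y := Nat.gcd_pos_of_pos_left _ hu
    have hc : Nat.Coprime (u / u.gcd y) (y / u.gcd y) := Nat.coprime_div_gcd_div_gcd hg
    have h1 : Nat.gcd (x * u / u.gcd y) (x * (y / u.gcd y)) = x := by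
      rw [Nat.mul_div_assoc _ (Nat.gcd_dvd_left _ _), Nat.gcd_mul_left, hc.gcd_eq_one, mul_one]
    simp only [Nat.mul_div_cancel_left _ hx, h1, Prod.mk.injEq, true_and]
    exact Nat.div_mul_cancel (Nat.gcd_dvd_right _ _)
  · rintro ⟨d, e⟩ h
    simp only [Nat.mem_divisors, Finset.mem_sigma] at h
    obtain ⟨⟨hd, -⟩, he, -⟩ := h
    obtain ⟨u, rfl⟩ := hd.trans (Nat.gcd_dvd_left _ _)
    have hd0 : 0 < d := Nat.pos_of_ne_zero (left_ne_zero_of_mul ha)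
    have hu : 0 < u := Nat.pos_of_ne_zero (right_ne_zero_of_mul ha)
    have hg : 0 < u.gcd e := Nat.gcd_pos_of_pos_left _ hu
    have hc : Nat.Coprime (u / u.gcd e) (e / u.gcd e) := Nat.coprime_div_gcd_div_gcd hg
    have h1 : Nat.gcd (d * u / u.gcd e) (e / u.gcd e * d) = d := by
      rw [Nat.mul_div_assoc _ (Nat.gcd_dvd_left _ _), mul_comm _ d, Nat.gcd_mul_left,
        hc.gcd_eq_one, mul_one]
    simp only [Nat.mul_div_cancel_left _ hd0, h1, Sigma.mk.injEq, true_and, heq_eq_eq]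
    rw [Nat.mul_div_cancel _ hd0]
    exact Nat.mul_div_cancel' (Nat.gcd_dvd_right _ _)
  · rintro ⟨x, y⟩ h
    simp only
    rw [← map_mul, ← map_mul, ← Nat.cast_mul, ← Nat.cast_mul, mul_left_comm,
      Nat.mul_div_cancel' (Nat.gcd_dvd_right _ _)]

theorem sum_chiDivisorSum_mul_chiDivisorSum (n : ℕ) :
    ∑ a ∈ Finset.Ico 1 n, chiDivisorSum a * chiDivisorSum (n - a) =
      ∑ d ∈ n.divisors, ZMod.χ₄ (d : ZMod 4) *
        ∑ a ∈ Finset.Ico 1 (n / d), chiDivisorSum (a * (n / d - a)) := by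
  have h1 : ∀ a ∈ Finset.Ico 1 n, chiDivisorSum a * chiDivisorSum (n - a) =
      ∑ d ∈ (a.gcd (n - a)).divisors,
        ZMod.χ₄ (d : ZMod 4) * chiDivisorSum (a / d * ((n - a) / d)) := by
    intro a ha
    rw [Finset.mem_Ico] at ha
    exact chiDivisorSum_mul_chiDivisorSum (by omega) (by omega)
  rw [Finset.sum_congr rfl h1]
  simp only [Finset.mul_sum]
  rw [Finset.sum_sigma', Finset.sum_sigma']
  refine Finset.sum_bij' (fun v _ => (⟨v.2, v.1 / v.2⟩ : (_ : ℕ) × ℕ))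
    (fun w _ => (⟨w.1 * w.2, w.1⟩ : (_ : ℕ) × ℕ)) ?_ ?_ ?_ ?_ ?_
  · rintro ⟨a, d⟩ h
    simp only [Finset.mem_sigma, Finset.mem_Ico, Nat.mem_divisors] at h ⊢
    obtain ⟨⟨h1, h2⟩, h3, h4⟩ := h
    have hda : d ∣ a := h3.trans (Nat.gcd_dvd_left _ _)
    have hdn : d ∣ n := by
      have := dvd_add hda (h3.trans (Nat.gcd_dvd_right _ _))
      rwa [Nat.add_sub_cancel' h2.le] at this
    have hd0 : 0 < d := Nat.pos_of_dvd_of_pos hda h1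
    refine ⟨⟨hdn, by omega⟩, Nat.div_pos (Nat.le_of_dvd h1 hda) hd0, ?_⟩
    exact Nat.div_lt_div_of_lt_of_dvd hdn h2
  · rintro ⟨d, a⟩ h
    simp only [Finset.mem_sigma, Finset.mem_Ico, Nat.mem_divisors] at h ⊢
    obtain ⟨⟨⟨m, rfl⟩, h0⟩, h1, h2⟩ := h
    have hd0 : 0 < d := Nat.pos_of_ne_zero (left_ne_zero_of_mul h0)
    rw [Nat.mul_div_cancel_left _ hd0] at h2
    have h3 : 0 < d * a := Nat.mul_pos hd0 h1
    refine ⟨⟨h3, Nat.mul_lt_mul_of_pos_left h2 hd0⟩, ?_, ?_⟩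
    · rw [← Nat.mul_sub]
      exact Nat.dvd_gcd (dvd_mul_right _ _) (dvd_mul_right _ _)
    · exact (Nat.gcd_pos_of_pos_left _ h3).ne'
  · rintro ⟨a, d⟩ h
    simp only [Finset.mem_sigma, Finset.mem_Ico, Nat.mem_divisors] at h
    have hda : d ∣ a := h.2.1.trans (Nat.gcd_dvd_left _ _)
    simp only [Nat.mul_div_cancel' hda]
  · rintro ⟨d, a⟩ h
    simp only [Finset.mem_sigma, Nat.mem_divisors] at h
    have hd0 : 0 < d := Nat.pos_of_dvd_of_pos h.1.1 (Nat.pos_of_ne_zero h.1.2)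
    simp only [Nat.mul_div_cancel_left _ hd0]
  · rintro ⟨a, d⟩ h
    simp only [Finset.mem_sigma, Finset.mem_Ico, Nat.mem_divisors] at h
    obtain ⟨m, hm⟩ := h.2.1.trans (Nat.gcd_dvd_left _ _)
    obtain ⟨k, hk⟩ := h.2.1.trans (Nat.gcd_dvd_right _ _)
    have hd0 : 0 < d := Nat.pos_of_dvd_of_pos (hm ▸ dvd_mul_right _ _) h.1.1
    have hn : n = d * (m + k) := by rw [mul_add, ← hm, ← hk]; omega
    simp only
    rw [hk, hm, hn, Nat.mul_div_cancel_left _ hd0, Nat.mul_div_cancel_left _ hd0,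
      Nat.mul_div_cancel_left _ hd0, Nat.add_sub_cancel_left]

/-- The even function `k ↦ cos (π k / 2)` on the integers. -/
def quarterCos (k : ℤ) : ℤ := if k % 4 = 0 then 1 else if k % 4 = 2 then -1 else 0

theorem quarterCos_neg (k : ℤ) : quarterCos (-k) = quarterCos k := by
  unfold quarterCos
  split_ifs <;> first | rfl | omega

theorem quarterCos_of_odd {k : ℕ} (hk : Odd k) : quarterCos k = 0 := by
  obtain ⟨m, rfl⟩ := hk
  unfold quarterCos
  push_cast
  split_ifs <;> first | rfl | omega

theorem quarterCos_sub_sub_quarterCos_add (a b : ℕ) :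
    quarterCos ((a : ℤ) - b) - quarterCos ((a : ℤ) + b) =
      2 * (ZMod.χ₄ (a : ZMod 4) * ZMod.χ₄ (b : ZMod 4)) := by
  rw [ZMod.χ₄_nat_eq_if_mod_four, ZMod.χ₄_nat_eq_if_mod_four]
  unfold quarterCos
  split_ifs <;> first | rfl | omega

theorem two_mul_sum_quarterCos {d : ℕ} (hd : Odd d) :
    2 * ∑ l ∈ Finset.Ico 1 d, quarterCos l = ZMod.χ₄ (d : ZMod 4) - 1 := by
  obtain ⟨m, rfl⟩ := hd
  induction m with
  | zero => simp
  | succ k ih =>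
    rw [show 2 * (k + 1) + 1 = 2 * k + 1 + 1 + 1 by ring, Finset.sum_Ico_succ_top (by omega),
      Finset.sum_Ico_succ_top (by omega), mul_add, mul_add, ih, ZMod.χ₄_nat_eq_if_mod_four,
      ZMod.χ₄_nat_eq_if_mod_four]
    unfold quarterCos
    push_cast
    split_ifs <;> first | rfl | omega

/-- The quadruples `(a, x, b, y)` of positive integers with `a * x + b * y = n`. -/
def posQuads (n : ℕ) : Finset (ℕ × ℕ × ℕ × ℕ) :=
  (Finset.Icc 1 n ×ˢ Finset.Icc 1 n ×ˢ Finset.Icc 1 n ×ˢ Finset.Icc 1 n).filter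
    fun v => v.1 * v.2.1 + v.2.2.1 * v.2.2.2 = n

theorem mem_posQuads {n a x b y : ℕ} :
    (a, x, b, y) ∈ posQuads n ↔ 0 < a ∧ 0 < x ∧ 0 < b ∧ 0 < y ∧ a * x + b * y = n := by
  simp only [posQuads, Finset.mem_filter, Finset.mem_product, Finset.mem_Icc]
  constructor
  · rintro ⟨⟨h1, h2, h3, h4⟩, h⟩
    exact ⟨h1.1, h2.1, h3.1, h4.1, h⟩
  · rintro ⟨h1, h2, h3, h4, h⟩
    have e1 := Nat.le_mul_of_pos_right a h2
    have e2 := Nat.le_mul_of_pos_left x h1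
    have e3 := Nat.le_mul_of_pos_right b h4
    have e4 := Nat.le_mul_of_pos_left y h3
    exact ⟨⟨⟨h1, by omega⟩, ⟨h2, by omega⟩, ⟨h3, by omega⟩, ⟨h4, by omega⟩⟩, h⟩

/-- Splitting a sum over quadruples by comparing two coordinates. -/
theorem sum_posQuads_eq_add_add (n : ℕ) (u w : ℕ × ℕ × ℕ × ℕ → ℕ) (F : ℕ × ℕ × ℕ × ℕ → ℤ) :
    ∑ v ∈ posQuads n, F v = ∑ v ∈ posQuads n with u v = w v, F v +
      ∑ v ∈ posQuads n with u v < w v, F v + ∑ v ∈ posQuads n with w v < u v, F v := by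
  simp only [Finset.sum_filter]
  rw [← Finset.sum_add_distrib, ← Finset.sum_add_distrib]
  refine Finset.sum_congr rfl fun v _ => ?_
  rcases lt_trichotomy (u v) (w v) with h | h | h
  · simp [h, h.ne, h.not_gt]
  · simp [h]
  · simp [h, h.ne', h.not_gt]

theorem sum_posQuads_swap_sub (n : ℕ) :
    ∑ v ∈ posQuads n with v.1 < v.2.2.1, quarterCos ((v.1 : ℤ) - v.2.2.1) =
      ∑ v ∈ posQuads n with v.2.2.1 < v.1, quarterCos ((v.1 : ℤ) - v.2.2.1) := by
  refine Finset.sum_nbij' (fun v => (v.2.2.1, v.2.2.2, v.1, v.2.1))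
    (fun v => (v.2.2.1, v.2.2.2, v.1, v.2.1)) ?_ ?_ ?_ ?_ ?_
  · rintro ⟨a, x, b, y⟩
    simp only [Finset.mem_filter, mem_posQuads]
    grind
  · rintro ⟨a, x, b, y⟩
    simp only [Finset.mem_filter, mem_posQuads]
    grind
  · intro v _
    rfl
  · intro v _
    rfl
  · intro v _
    rw [← quarterCos_neg, neg_sub]

theorem sum_posQuads_swap_add (n : ℕ) :
    ∑ v ∈ posQuads n with v.2.2.2 < v.2.1, quarterCos ((v.1 : ℤ) + v.2.2.1) =
      ∑ v ∈ posQuads n with v.2.1 < v.2.2.2, quarterCos ((v.1 : ℤ) + v.2.2.1) := by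
  refine Finset.sum_nbij' (fun v => (v.2.2.1, v.2.2.2, v.1, v.2.1))
    (fun v => (v.2.2.1, v.2.2.2, v.1, v.2.1)) ?_ ?_ ?_ ?_ ?_
  · rintro ⟨a, x, b, y⟩
    simp only [Finset.mem_filter, mem_posQuads]
    grind
  · rintro ⟨a, x, b, y⟩
    simp only [Finset.mem_filter, mem_posQuads]
    grind
  · intro v _
    rfl
  · intro v _
    rfl
  · intro v _
    rw [add_comm]

theorem sum_posQuads_shift_sub (n : ℕ) :
    ∑ v ∈ posQuads n with v.2.2.1 < v.1, quarterCos ((v.1 : ℤ) - v.2.2.1) =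
      ∑ v ∈ posQuads n with v.2.1 < v.2.2.2, quarterCos v.1 := by
  refine Finset.sum_nbij' (fun v => (v.1 - v.2.2.1, v.2.1, v.2.2.1, v.2.1 + v.2.2.2))
    (fun v => (v.1 + v.2.2.1, v.2.1, v.2.2.1, v.2.2.2 - v.2.1)) ?_ ?_ ?_ ?_ ?_
  · rintro ⟨a, x, b, y⟩
    simp only [Finset.mem_filter, mem_posQuads]
    rintro ⟨⟨h1, h2, h3, h4, h⟩, h5⟩
    obtain ⟨c, rfl⟩ := Nat.exists_eq_add_of_lt h5
    refine ⟨⟨by omega, h2, h3, by omega, ?_⟩, by omega⟩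
    rw [show b + c + 1 - b = c + 1 by omega]
    linarith
  · rintro ⟨a, x, b, y⟩
    simp only [Finset.mem_filter, mem_posQuads]
    rintro ⟨⟨h1, h2, h3, h4, h⟩, h5⟩
    obtain ⟨c, rfl⟩ := Nat.exists_eq_add_of_lt h5
    refine ⟨⟨by omega, h2, h3, by omega, ?_⟩, by omega⟩
    rw [show x + c + 1 - x = c + 1 by omega]
    linarith
  · rintro ⟨a, x, b, y⟩
    simp only [Finset.mem_filter, Prod.mk.injEq, true_and]
    rintro ⟨-, h⟩
    omega
  · rintro ⟨a, x, b, y⟩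
    simp only [Finset.mem_filter, Prod.mk.injEq, true_and]
    rintro ⟨-, h⟩
    omega
  · rintro ⟨a, x, b, y⟩
    simp only [Finset.mem_filter]
    rintro ⟨-, h⟩
    rw [Nat.cast_sub h.le]

theorem sum_posQuads_shift_add (n : ℕ) :
    ∑ v ∈ posQuads n with v.2.1 < v.2.2.2, quarterCos ((v.1 : ℤ) + v.2.2.1) =
      ∑ v ∈ posQuads n with v.2.2.1 < v.1, quarterCos v.1 := by
  refine Finset.sum_nbij' (fun v => (v.1 + v.2.2.1, v.2.1, v.2.2.1, v.2.2.2 - v.2.1))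
    (fun v => (v.1 - v.2.2.1, v.2.1, v.2.2.1, v.2.1 + v.2.2.2)) ?_ ?_ ?_ ?_ ?_
  · rintro ⟨a, x, b, y⟩
    simp only [Finset.mem_filter, mem_posQuads]
    rintro ⟨⟨h1, h2, h3, h4, h⟩, h5⟩
    obtain ⟨c, rfl⟩ := Nat.exists_eq_add_of_lt h5
    refine ⟨⟨by omega, h2, h3, by omega, ?_⟩, by omega⟩
    rw [show x + c + 1 - x = c + 1 by omega]
    linarith
  · rintro ⟨a, x, b, y⟩
    simp only [Finset.mem_filter, mem_posQuads]
    rintro ⟨⟨h1, h2, h3, h4, h⟩, h5⟩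
    obtain ⟨c, rfl⟩ := Nat.exists_eq_add_of_lt h5
    refine ⟨⟨by omega, h2, h3, by omega, ?_⟩, by omega⟩
    rw [show b + c + 1 - b = c + 1 by omega]
    linarith
  · rintro ⟨a, x, b, y⟩
    simp only [Finset.mem_filter, Prod.mk.injEq, true_and]
    rintro ⟨-, h⟩
    omega
  · rintro ⟨a, x, b, y⟩
    simp only [Finset.mem_filter, Prod.mk.injEq, true_and]
    rintro ⟨-, h⟩
    omega
  · rintro ⟨a, x, b, y⟩ _
    push_cast
    rfl

theorem sum_posQuads_euclid (n : ℕ) :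
    ∑ v ∈ posQuads n with v.1 < v.2.2.1, quarterCos v.1 =
      ∑ v ∈ posQuads n with v.2.2.2 < v.2.1, quarterCos v.1 := by
  refine Finset.sum_nbij' (fun v => (v.1, v.2.1 + v.2.2.2, v.2.2.1 - v.1, v.2.2.2))
    (fun v => (v.1, v.2.1 - v.2.2.2, v.2.2.1 + v.1, v.2.2.2)) ?_ ?_ ?_ ?_ ?_
  · rintro ⟨a, x, b, y⟩
    simp only [Finset.mem_filter, mem_posQuads]
    rintro ⟨⟨h1, h2, h3, h4, h⟩, h5⟩
    obtain ⟨c, rfl⟩ := Nat.exists_eq_add_of_lt h5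
    refine ⟨⟨h1, by omega, by omega, h4, ?_⟩, by omega⟩
    rw [show a + c + 1 - a = c + 1 by omega]
    linarith
  · rintro ⟨a, x, b, y⟩
    simp only [Finset.mem_filter, mem_posQuads]
    rintro ⟨⟨h1, h2, h3, h4, h⟩, h5⟩
    obtain ⟨c, rfl⟩ := Nat.exists_eq_add_of_lt h5
    refine ⟨⟨h1, by omega, by omega, h4, ?_⟩, by omega⟩
    rw [show y + c + 1 - y = c + 1 by omega]
    linarith
  · rintro ⟨a, x, b, y⟩
    simp only [Finset.mem_filter, Prod.mk.injEq, true_and, and_true]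
    rintro ⟨-, h⟩
    omega
  · rintro ⟨a, x, b, y⟩
    simp only [Finset.mem_filter, Prod.mk.injEq, true_and, and_true]
    rintro ⟨-, h⟩
    omega
  · intro v _
    rfl

theorem sum_posQuads_fst_eq_sub {n : ℕ} :
    ∑ v ∈ posQuads n with v.1 = v.2.2.1, quarterCos ((v.1 : ℤ) - v.2.2.1) =
      ∑ d ∈ n.divisors, ((d : ℤ) - 1) := by
  have h1 : ∀ d ∈ n.divisors, ((d : ℤ) - 1) = ∑ _x ∈ Finset.Ico 1 d, (1 : ℤ) := by
    intro d hd
    have := Nat.pos_of_mem_divisors hd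
    rw [Finset.sum_const, Nat.card_Ico, nsmul_eq_mul, mul_one, Nat.cast_sub this, Nat.cast_one]
  rw [Finset.sum_congr rfl h1, Finset.sum_sigma']
  refine Finset.sum_bij' (fun v _ => (⟨v.2.1 + v.2.2.2, v.2.1⟩ : (_ : ℕ) × ℕ))
    (fun w _ => (n / w.1, w.2, n / w.1, w.1 - w.2)) ?_ ?_ ?_ ?_ ?_
  · rintro ⟨a, x, b, y⟩ h
    simp only [Finset.mem_filter, mem_posQuads, Finset.mem_sigma, Nat.mem_divisors,
      Finset.mem_Ico] at h ⊢
    obtain ⟨⟨h1, h2, h3, h4, h⟩, rfl⟩ := h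
    have : 0 < a * x := Nat.mul_pos h1 h2
    exact ⟨⟨⟨a, by rw [← h]; ring⟩, by omega⟩, by omega, by omega⟩
  · rintro ⟨d, x⟩ h
    simp only [Finset.mem_filter, mem_posQuads, Finset.mem_sigma, Nat.mem_divisors,
      Finset.mem_Ico] at h ⊢
    obtain ⟨⟨hd, hn⟩, h1, h2⟩ := h
    have h3 : 0 < n / d := Nat.div_pos (Nat.le_of_dvd (Nat.pos_of_ne_zero hn) hd) (by omega)
    refine ⟨⟨h3, h1, h3, by omega, ?_⟩, trivial⟩
    rw [← mul_add, Nat.add_sub_cancel' h2.le, Nat.div_mul_cancel hd]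
  · rintro ⟨a, x, b, y⟩ h
    simp only [Finset.mem_filter, mem_posQuads] at h
    obtain ⟨⟨h1, h2, h3, h4, h⟩, rfl⟩ := h
    have : n / (x + y) = a := by
      rw [← h, ← mul_add, Nat.mul_div_cancel _ (by omega)]
    simp only [this, Prod.mk.injEq, true_and]
    omega
  · rintro ⟨d, x⟩ h
    simp only [Finset.mem_sigma, Finset.mem_Ico] at h
    simp only [Nat.add_sub_cancel' h.2.2.le]
  · rintro ⟨a, x, b, y⟩ h
    simp only [Finset.mem_filter] at h
    obtain ⟨-, rfl⟩ := h
    simp [quarterCos]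

theorem sum_posQuads_snd_eq {n : ℕ} :
    ∑ v ∈ posQuads n with v.2.1 = v.2.2.2, quarterCos v.1 =
      ∑ d ∈ n.divisors, ∑ l ∈ Finset.Ico 1 d, quarterCos l := by
  rw [Finset.sum_sigma']
  refine Finset.sum_bij' (fun v _ => (⟨v.1 + v.2.2.1, v.1⟩ : (_ : ℕ) × ℕ))
    (fun w _ => (w.2, n / w.1, w.1 - w.2, n / w.1)) ?_ ?_ ?_ ?_ ?_
  · rintro ⟨a, x, b, y⟩ h
    simp only [Finset.mem_filter, mem_posQuads, Finset.mem_sigma, Nat.mem_divisors,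
      Finset.mem_Ico] at h ⊢
    obtain ⟨⟨h1, h2, h3, h4, h⟩, rfl⟩ := h
    have : 0 < a * x := Nat.mul_pos h1 h2
    exact ⟨⟨⟨x, by rw [← h]; ring⟩, by omega⟩, by omega, by omega⟩
  · rintro ⟨d, x⟩ h
    simp only [Finset.mem_filter, mem_posQuads, Finset.mem_sigma, Nat.mem_divisors,
      Finset.mem_Ico] at h ⊢
    obtain ⟨⟨hd, hn⟩, h1, h2⟩ := h
    have h3 : 0 < n / d := Nat.div_pos (Nat.le_of_dvd (Nat.pos_of_ne_zero hn) hd) (by omega)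
    refine ⟨⟨h1, h3, by omega, h3, ?_⟩, trivial⟩
    rw [← add_mul, Nat.add_sub_cancel' h2.le, Nat.mul_div_cancel' hd]
  · rintro ⟨a, x, b, y⟩ h
    simp only [Finset.mem_filter, mem_posQuads] at h
    obtain ⟨⟨h1, h2, h3, h4, h⟩, rfl⟩ := h
    have : n / (a + b) = x := by
      rw [← h, ← add_mul, Nat.mul_div_cancel_left _ (by omega)]
    simp only [this, Prod.mk.injEq, true_and, and_true]
    omega
  · rintro ⟨d, x⟩ h
    simp only [Finset.mem_sigma, Finset.mem_Ico] at h
    simp only [Nat.add_sub_cancel' h.2.2.le]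
  · intro v _
    rfl

theorem sum_posQuads_fst_eq {n : ℕ} (hn : Odd n) :
    ∑ v ∈ posQuads n with v.1 = v.2.2.1, quarterCos v.1 = 0 := by
  apply Finset.sum_eq_zero
  rintro ⟨a, x, b, y⟩ h
  simp only [Finset.mem_filter, mem_posQuads] at h
  obtain ⟨⟨-, -, -, -, h⟩, rfl⟩ := h
  exact quarterCos_of_odd (hn.of_dvd_nat ⟨x + y, by rw [← h]; ring⟩)

theorem sum_posQuads_snd_eq_add {n : ℕ} (hn : Odd n) :
    ∑ v ∈ posQuads n with v.2.1 = v.2.2.2, quarterCos ((v.1 : ℤ) + v.2.2.1) = 0 := by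
  apply Finset.sum_eq_zero
  rintro ⟨a, x, b, y⟩ h
  simp only [Finset.mem_filter, mem_posQuads] at h
  obtain ⟨⟨-, -, -, -, h⟩, rfl⟩ := h
  have := quarterCos_of_odd (k := a + b) (hn.of_dvd_nat ⟨x, by rw [← h]; ring⟩)
  simpa using this

theorem sum_posQuads_chi (n : ℕ) :
    ∑ v ∈ posQuads n, ZMod.χ₄ (v.1 : ZMod 4) * ZMod.χ₄ (v.2.2.1 : ZMod 4) =
      ∑ m ∈ Finset.Ico 1 n, chiDivisorSum m * chiDivisorSum (n - m) := by
  simp only [chiDivisorSum]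
  simp_rw [Finset.sum_mul_sum, ← Finset.sum_product']
  rw [Finset.sum_sigma']
  refine Finset.sum_bij'
    (fun v _ => (⟨v.1 * v.2.1, (v.1, v.2.2.1)⟩ : (_ : ℕ) × (ℕ × ℕ)))
    (fun w _ => (w.2.1, w.1 / w.2.1, w.2.2, (n - w.1) / w.2.2)) ?_ ?_ ?_ ?_ ?_
  · rintro ⟨a, x, b, y⟩ h
    simp only [mem_posQuads, Finset.mem_sigma, Nat.mem_divisors, Finset.mem_product,
      Finset.mem_Ico] at h ⊢
    obtain ⟨h1, h2, h3, h4, rfl⟩ := h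
    have e1 : 0 < a * x := Nat.mul_pos h1 h2
    have e2 : 0 < b * y := Nat.mul_pos h3 h4
    rw [Nat.add_sub_cancel_left]
    exact ⟨⟨e1, by omega⟩, ⟨dvd_mul_right _ _, e1.ne'⟩, ⟨dvd_mul_right _ _, e2.ne'⟩⟩
  · rintro ⟨m, a, b⟩ h
    simp only [mem_posQuads, Finset.mem_sigma, Nat.mem_divisors, Finset.mem_product,
      Finset.mem_Ico] at h ⊢
    obtain ⟨⟨h1, h2⟩, ⟨ha, -⟩, ⟨hb, h3⟩⟩ := h
    have h4 := Nat.pos_of_ne_zero h3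
    refine ⟨Nat.pos_of_dvd_of_pos ha h1, Nat.div_pos (Nat.le_of_dvd h1 ha)
      (Nat.pos_of_dvd_of_pos ha h1), Nat.pos_of_dvd_of_pos hb h4, Nat.div_pos
      (Nat.le_of_dvd h4 hb) (Nat.pos_of_dvd_of_pos hb h4), ?_⟩
    rw [Nat.mul_div_cancel' ha, Nat.mul_div_cancel' hb]
    omega
  · rintro ⟨a, x, b, y⟩ h
    rw [mem_posQuads] at h
    obtain ⟨h1, h2, h3, h4, rfl⟩ := h
    simp only [Nat.add_sub_cancel_left, Nat.mul_div_cancel_left _ h1, Nat.mul_div_cancel_left _ h3]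
  · rintro ⟨m, a, b⟩ h
    simp only [Finset.mem_sigma, Nat.mem_divisors, Finset.mem_product] at h
    simp only [Nat.mul_div_cancel' h.2.1.1]
  · intro v _
    rfl

/-- A case of Liouville's identity. -/
theorem two_mul_sum_chiDivisorSum_mul {n : ℕ} (hn : Odd n) :
    2 * ∑ m ∈ Finset.Ico 1 n, chiDivisorSum m * chiDivisorSum (n - m) =
      ∑ d ∈ n.divisors, (d : ℤ) - chiDivisorSum n := by
  rw [← sum_posQuads_chi, Finset.mul_sum]
  simp_rw [← quarterCos_sub_sub_quarterCos_add]
  rw [Finset.sum_sub_distrib]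
  have e1 := sum_posQuads_eq_add_add n (fun v => v.1) (fun v => v.2.2.1)
    (fun v => quarterCos ((v.1 : ℤ) - v.2.2.1))
  have e2 := sum_posQuads_eq_add_add n (fun v => v.2.1) (fun v => v.2.2.2)
    (fun v => quarterCos ((v.1 : ℤ) + v.2.2.1))
  have e3 := sum_posQuads_eq_add_add n (fun v => v.1) (fun v => v.2.2.1)
    (fun v => quarterCos v.1)
  have e4 := sum_posQuads_eq_add_add n (fun v => v.2.1) (fun v => v.2.2.2)
    (fun v => quarterCos v.1)
  rw [sum_posQuads_fst_eq_sub, sum_posQuads_swap_sub, sum_posQuads_shift_sub] at e1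
  rw [sum_posQuads_snd_eq_add hn, sum_posQuads_swap_add, sum_posQuads_shift_add] at e2
  rw [sum_posQuads_fst_eq hn, sum_posQuads_euclid] at e3
  rw [sum_posQuads_snd_eq] at e4
  have e5 : 2 * ∑ d ∈ n.divisors, ∑ l ∈ Finset.Ico 1 d, quarterCos l =
      ∑ d ∈ n.divisors, (ZMod.χ₄ (d : ZMod 4) - 1) := by
    rw [Finset.mul_sum]
    exact Finset.sum_congr rfl fun d hd =>
      two_mul_sum_quarterCos (hn.of_dvd_nat (Nat.dvd_of_mem_divisors hd))
  rw [Finset.sum_sub_distrib] at e1 e5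
  rw [chiDivisorSum]
  linarith

theorem finite_tVal (n : ℤ) : {v : ℤ × ℤ × ℤ | tVal 1 2 2 v = n}.Finite := by
  refine ((Set.finite_Icc (-n) n).prod
    ((Set.finite_Icc (-n) n).prod (Set.finite_Icc (-n) n))).subset ?_
  rintro ⟨x, y, z⟩ h
  simp only [Set.mem_ofPred_eq, tVal] at h
  simp only [Set.mem_prod, Set.mem_Icc]
  refine ⟨⟨?_, ?_⟩, ⟨?_, ?_⟩, ?_, ?_⟩ <;>
    nlinarith [Int.le_self_sq x, Int.le_self_sq y, Int.le_self_sq (-x), Int.le_self_sq (-y),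
      Int.le_self_sq z, Int.le_self_sq (-z), sq_nonneg x, sq_nonneg y, sq_nonneg z]

theorem tRep_sq_eq_sum {n : ℕ} (hn : Odd n) :
    tRep 1 2 2 ((n : ℤ) ^ 2) =
      ∑ a ∈ Finset.range (n + 1), sqAddSqCount (2 * (a * (n - a))) := by
  have hfin := finite_tVal ((n : ℤ) ^ 2)
  have hn' : Odd (n : ℤ) := by exact_mod_cast hn
  have hpar : ∀ v : ℤ × ℤ × ℤ, tVal 1 2 2 v = (n : ℤ) ^ 2 →
      ∃ c : ℕ, c ≤ n ∧ v.1 = n - 2 * c := by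
    rintro ⟨x, y, z⟩ h
    simp only [tVal] at h ⊢
    have hx : Odd x := by
      rw [← Int.not_even_iff_odd]
      rintro ⟨w, rfl⟩
      have : Even ((n : ℤ) ^ 2) := ⟨2 * w ^ 2 + y ^ 2 + z ^ 2, by rw [← h]; ring⟩
      exact Int.not_even_iff_odd.2 hn'.pow this
    obtain ⟨c, hc⟩ := hn'.sub_odd hx
    have hle : |x| ≤ |(n : ℤ)| := sq_le_sq.1 (by nlinarith [sq_nonneg y, sq_nonneg z])
    rw [Nat.abs_cast, abs_le] at hle
    lift c to ℕ using by omega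
    exact ⟨c, by omega, by omega⟩
  rw [tRep, Set.ncard_eq_toFinset_card _ hfin, Finset.card_eq_sum_card_fiberwise
    (f := fun v : ℤ × ℤ × ℤ => (((n : ℤ) - v.1) / 2).toNat) (t := Finset.range (n + 1))]
  · refine Finset.sum_congr rfl fun a ha => ?_
    have ha' : a ≤ n := Nat.lt_succ_iff.1 (Finset.mem_range.1 ha)
    have hinj : Function.Injective (fun v : ℤ × ℤ => ((n : ℤ) - 2 * a, v)) :=
      fun _ _ h => (Prod.mk.inj h).2
    rw [← Set.ncard_coe_finset, sqAddSqCount, ← Set.ncard_image_of_injective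
      {v : ℤ × ℤ | v.1 ^ 2 + v.2 ^ 2 = ((2 * (a * (n - a)) : ℕ) : ℤ)} hinj]
    congr 1
    ext ⟨x, y, z⟩
    simp only [Finset.coe_filter, Set.Finite.mem_toFinset, Set.mem_ofPred_eq, Set.mem_image,
      Prod.mk.injEq, Prod.exists]
    push_cast [Nat.cast_sub ha']
    constructor
    · rintro ⟨h, hc⟩
      obtain ⟨c, -, hx⟩ := hpar _ h
      simp only at hx
      have : c = a := by omega
      subst this
      refine ⟨?_, hx.symm, rfl, rfl⟩
      simp only [tVal] at h
      subst hx
      linarith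
    · rintro ⟨h, hx, -, -⟩
      subst hx
      refine ⟨?_, by omega⟩
      simp only [tVal]
      linarith
  · intro v hv
    rw [Finset.mem_coe, Set.Finite.mem_toFinset] at hv
    obtain ⟨c, hc, hv⟩ := hpar v hv
    simp only [Finset.mem_coe, Finset.mem_range]
    omega

theorem tRep_sq_eq_add_sum {n : ℕ} (hn : Odd n) :
    (tRep 1 2 2 ((n : ℤ) ^ 2) : ℤ) =
      2 + 4 * ∑ a ∈ Finset.Ico 1 n, chiDivisorSum (a * (n - a)) := by
  have hpos := hn.pos
  rw [tRep_sq_eq_sum hn, Finset.sum_range_succ, Finset.range_eq_Ico,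
    Finset.sum_eq_sum_Ico_succ_bot hpos, Nat.sub_self, zero_mul, mul_zero, mul_zero,
    sqAddSqCount_zero, Finset.mul_sum]
  push_cast
  have : ∀ a ∈ Finset.Ico 1 n, (sqAddSqCount (2 * (a * (n - a))) : ℤ) =
      4 * chiDivisorSum (a * (n - a)) := by
    intro a ha
    rw [Finset.mem_Ico] at ha
    rw [sqAddSqCount_two_mul, sqAddSqCount_eq _ (mul_ne_zero (by omega) (by omega))]
  rw [Finset.sum_congr rfl this, sqAddSqCount_zero]
  push_cast
  ring

theorem sum_chi_mul_tRep_sq {n : ℕ} (hn : Odd n) :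
    ∑ d ∈ n.divisors, ZMod.χ₄ (d : ZMod 4) * (tRep 1 2 2 (((n / d : ℕ) : ℤ) ^ 2) : ℤ) =
      2 * ∑ d ∈ n.divisors, (d : ℤ) := by
  have h1 : ∀ d ∈ n.divisors,
      ZMod.χ₄ (d : ZMod 4) * (tRep 1 2 2 (((n / d : ℕ) : ℤ) ^ 2) : ℤ) =
        2 * ZMod.χ₄ (d : ZMod 4) + 4 * (ZMod.χ₄ (d : ZMod 4) *
          ∑ a ∈ Finset.Ico 1 (n / d), chiDivisorSum (a * (n / d - a))) := by
    intro d hd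
    rw [tRep_sq_eq_add_sum (hn.of_dvd_nat (Nat.div_dvd_of_dvd (Nat.dvd_of_mem_divisors hd)))]
    ring
  rw [Finset.sum_congr rfl h1, Finset.sum_add_distrib, ← Finset.mul_sum, ← Finset.mul_sum,
    ← sum_chiDivisorSum_mul_chiDivisorSum]
  have h2 := two_mul_sum_chiDivisorSum_mul hn
  rw [show ∑ d ∈ n.divisors, ZMod.χ₄ (d : ZMod 4) = chiDivisorSum n from rfl]
  linarith

/-- The nontrivial character mod 4 as an arithmetic function. -/
def chiFun : ArithmeticFunction ℤ := ⟨fun n => ZMod.χ₄ (n : ZMod 4), by simp⟩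

theorem chiFun_apply (n : ℕ) : chiFun n = ZMod.χ₄ (n : ZMod 4) := rfl

theorem chiFun_isMultiplicative : chiFun.IsMultiplicative :=
  ⟨by simp [chiFun_apply], fun {m n} _ => by simp only [chiFun_apply, Nat.cast_mul, map_mul]⟩

theorem pmul_chiFun_mul (f g : ArithmeticFunction ℤ) :
    chiFun.pmul (f * g) = chiFun.pmul f * chiFun.pmul g := by
  ext n
  simp only [ArithmeticFunction.pmul_apply, ArithmeticFunction.mul_apply, Finset.mul_sum]
  refine Finset.sum_congr rfl fun x hx => ?_
  rw [← (Nat.mem_divisorsAntidiagonal.1 hx).1, chiFun_apply, chiFun_apply, chiFun_apply,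
    Nat.cast_mul, map_mul]
  ring

/-- The Dirichlet quotient of the sum-of-divisors function by the nontrivial character mod 4. -/
def chiSigma : ArithmeticFunction ℤ :=
  chiFun.pmul ArithmeticFunction.moebius * ((ArithmeticFunction.sigma 1 : ArithmeticFunction ℕ) :
    ArithmeticFunction ℤ)

theorem chiSigma_isMultiplicative : chiSigma.IsMultiplicative :=
  (chiFun_isMultiplicative.pmul ArithmeticFunction.isMultiplicative_moebius).mul
    ArithmeticFunction.isMultiplicative_sigma.natCast

theorem chiFun_mul_chiSigma :
    chiFun * chiSigma = ((ArithmeticFunction.sigma 1 : ArithmeticFunction ℕ) :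
      ArithmeticFunction ℤ) := by
  have h1 : chiFun = chiFun.pmul (ArithmeticFunction.zeta : ArithmeticFunction ℤ) := by
    rw [ArithmeticFunction.pmul_zeta]
  have h2 : chiFun.pmul (1 : ArithmeticFunction ℤ) = 1 := by
    ext n
    rw [ArithmeticFunction.pmul_apply, ArithmeticFunction.one_apply]
    split_ifs with h
    · simp [h, chiFun_apply]
    · simp
  rw [chiSigma, ← mul_assoc]
  nth_rewrite 1 [h1]
  rw [← pmul_chiFun_mul, ArithmeticFunction.coe_zeta_mul_moebius, h2, one_mul]

theorem sum_chi_mul_chiSigma (n : ℕ) :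
    ∑ d ∈ n.divisors, ZMod.χ₄ (d : ZMod 4) * chiSigma (n / d) = ∑ d ∈ n.divisors, (d : ℤ) := by
  have := congrArg (fun f : ArithmeticFunction ℤ => f n) chiFun_mul_chiSigma
  simp only [ArithmeticFunction.mul_apply, ArithmeticFunction.natCoe_apply,
    ArithmeticFunction.sigma_one_apply] at this
  rw [Nat.sum_divisorsAntidiagonal (fun d e => chiFun d * chiSigma e)] at this
  simpa only [chiFun_apply, Nat.cast_sum] using this

theorem tRep_sq_of_odd {n : ℕ} (hn : Odd n) :
    (tRep 1 2 2 ((n : ℤ) ^ 2) : ℤ) = 2 * chiSigma n := by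
  induction n using Nat.strong_induction_on with
  | _ n ih =>
    have h1 := sum_chi_mul_tRep_sq hn
    rw [← sum_chi_mul_chiSigma n, Finset.mul_sum] at h1
    have hmem : 1 ∈ n.divisors := Nat.one_mem_divisors.2 hn.pos.ne'
    rw [← Finset.add_sum_erase _ _ hmem, ← Finset.add_sum_erase _ _ hmem] at h1
    have h2 : ∀ d ∈ n.divisors.erase 1,
        ZMod.χ₄ (d : ZMod 4) * (tRep 1 2 2 (((n / d : ℕ) : ℤ) ^ 2) : ℤ) =
          2 * (ZMod.χ₄ (d : ZMod 4) * chiSigma (n / d)) := by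
      intro d hd
      rw [Finset.mem_erase] at hd
      have hd0 := Nat.pos_of_mem_divisors hd.2
      rw [ih (n / d) (Nat.div_lt_self hn.pos (by omega))
        (hn.of_dvd_nat (Nat.div_dvd_of_dvd (Nat.dvd_of_mem_divisors hd.2)))]
      ring
    rw [Finset.sum_congr rfl h2] at h1
    simpa using h1

theorem chiSigma_prime_pow {p : ℕ} (hp : p.Prime) (h2 : p ≠ 2) (k : ℕ) :
    chiSigma (p ^ k) = tHp 1 2 2 p k := by
  have hodd : Odd p := hp.odd_of_ne_two h2
  have hp1 : (p : ℤ) - 1 ≠ 0 := by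
    have := hp.two_le
    omega
  have hgeom (m : ℕ) : ((p : ℤ) ^ m - 1) / ((p : ℤ) - 1) = ∑ i ∈ Finset.range m, (p : ℤ) ^ i :=
    Int.ediv_eq_of_eq_mul_left hp1 (geom_sum_mul _ _).symm
  have hj : jacobiSym (-(1 * 2 * 2)) p = ZMod.χ₄ (p : ZMod 4) := by
    have hco : (2 : ℤ).gcd p = 1 := by
      have : Nat.gcd 2 p = 1 := (Nat.coprime_primes Nat.prime_two hp).2 h2.symm
      exact_mod_cast this
    rw [show (-(1 * 2 * 2) : ℤ) = -1 * 2 ^ 2 by norm_num, jacobiSym.mul_left,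
      jacobiSym.sq_one' hco, mul_one, jacobiSym.at_neg_one hodd]
  have hs (m : ℕ) := sum_chi_mul_chiSigma (p ^ m)
  simp only [Nat.sum_divisors_prime_pow hp, Nat.cast_pow] at hs
  rw [tHp, hgeom, hgeom, hj]
  cases k with
  | zero =>
    simpa using hs 0
  | succ k =>
    have h1 := hs (k + 1)
    rw [Finset.sum_range_succ'] at h1
    have h3 : ∀ i ∈ Finset.range (k + 1), ZMod.χ₄ ((p : ZMod 4) ^ (i + 1)) *
        chiSigma (p ^ (k + 1) / p ^ (i + 1)) =
        ZMod.χ₄ (p : ZMod 4) * (ZMod.χ₄ ((p : ZMod 4) ^ i) * chiSigma (p ^ k / p ^ i)) := by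
      intro i _
      rw [pow_succ p k, pow_succ p i, Nat.mul_div_mul_right _ _ hp.pos, pow_succ, map_mul]
      ring
    rw [Finset.sum_congr rfl h3, ← Finset.mul_sum, hs k] at h1
    simp only [pow_zero, map_one, one_mul, Nat.div_one] at h1
    linarith

theorem chiSigma_eq_prod {n : ℕ} (hn : Odd n) :
    chiSigma n = ∏ p ∈ n.primeFactors, tHp 1 2 2 p (n.factorization p) := by
  rw [chiSigma_isMultiplicative.multiplicative_factorization chiSigma hn.pos.ne', Finsupp.prod,
    Nat.support_factorization]
  refine Finset.prod_congr rfl fun p hp => ?_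
  have hp' := Nat.prime_of_mem_primeFactors hp
  refine chiSigma_prime_pow hp' ?_ _
  rintro rfl
  exact Nat.not_even_iff_odd.2 hn (even_iff_two_dvd.2 (Nat.dvd_of_mem_primeFactors hp))

theorem even_of_sq_add_two_mul {x y z m : ℤ} (h : x ^ 2 + 2 * y ^ 2 + 2 * z ^ 2 = 4 * m) :
    Even x := by
  have : Even (x ^ 2) := ⟨2 * m - y ^ 2 - z ^ 2, by linear_combination h⟩
  exact (Int.even_pow.1 this).1

theorem tRep_sixteen_mul (m : ℤ) : tRep 1 2 2 (16 * m) = tRep 1 2 2 (4 * m) := by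
  have hinj : Function.Injective (fun v : ℤ × ℤ × ℤ => (2 * v.1, 2 * v.2.1, 2 * v.2.2)) := by
    rintro ⟨x, y, z⟩ ⟨x', y', z'⟩ h
    simp only [Prod.mk.injEq] at h ⊢
    omega
  rw [tRep, tRep, ← Set.ncard_image_of_injective {v : ℤ × ℤ × ℤ | tVal 1 2 2 v = 4 * m} hinj]
  congr 1
  ext ⟨x, y, z⟩
  simp only [tVal, Set.mem_ofPred_eq, Set.mem_image, Prod.mk.injEq, Prod.exists]
  constructor
  · intro h
    obtain ⟨a, rfl⟩ := even_of_sq_add_two_mul (x := x) (y := y) (z := z) (m := 4 * m)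
      (by linear_combination h)
    have h8 : 2 * a ^ 2 + y ^ 2 + z ^ 2 = 8 * m := by linarith
    have hz : ((2 * a ^ 2 + y ^ 2 + z ^ 2 : ℤ) : ZMod 8) = 0 := by
      rw [h8, ZMod.intCast_zmod_eq_zero_iff_dvd]
      exact dvd_mul_right _ _
    have key : ∀ r s t : ZMod 8, 2 * r ^ 2 + s ^ 2 + t ^ 2 = 0 → 4 * s = 0 ∧ 4 * t = 0 := by
      decide
    push_cast at hz
    obtain ⟨hs, ht⟩ := key _ _ _ hz
    have hy : (8 : ℤ) ∣ 4 * y := by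
      rw [← Nat.cast_ofNat (n := 8), ← ZMod.intCast_zmod_eq_zero_iff_dvd]
      exact_mod_cast hs
    have hz : (8 : ℤ) ∣ 4 * z := by
      rw [← Nat.cast_ofNat (n := 8), ← ZMod.intCast_zmod_eq_zero_iff_dvd]
      exact_mod_cast ht
    obtain ⟨u, hu⟩ := hy
    obtain ⟨w, hw⟩ := hz
    obtain rfl : y = 2 * u := by omega
    obtain rfl : z = 2 * w := by omega
    exact ⟨a, u, w, by linarith, by ring, rfl, rfl⟩
  · rintro ⟨a, u, w, h, rfl, rfl, rfl⟩
    linarith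

theorem tRep_four_mul {m : ℤ} (hm : m % 4 = 1) : tRep 1 2 2 (4 * m) = 3 * tRep 1 2 2 m := by
  have sq4 : ∀ t : ℤ, t ^ 2 % 4 = if t % 2 = 0 then 0 else 1 := by
    intro t
    split_ifs with h
    · obtain ⟨k, rfl⟩ := Int.dvd_of_emod_eq_zero h
      ring_nf
      omega
    · obtain ⟨k, rfl⟩ : Odd t := Int.not_even_iff_odd.1 fun e => h (Int.even_iff.1 e)
      ring_nf
      omega
  set S := {v : ℤ × ℤ × ℤ | tVal 1 2 2 v = m} with hS
  have hfin := finite_tVal (4 * m)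
  have hinj₁ : Function.Injective (fun v : ℤ × ℤ × ℤ => (2 * v.1, 2 * v.2.1, 2 * v.2.2)) := by
    rintro ⟨x, y, z⟩ ⟨x', y', z'⟩ h
    simp only [Prod.mk.injEq] at h ⊢
    omega
  have hinj₂ : Function.Injective (fun v : ℤ × ℤ × ℤ =>
      (2 * (v.2.1 + v.2.2), v.1 + v.2.1 - v.2.2, v.1 - v.2.1 + v.2.2)) := by
    rintro ⟨x, y, z⟩ ⟨x', y', z'⟩ h
    simp only [Prod.mk.injEq] at h ⊢
    omega
  have hinj₃ : Function.Injective (fun v : ℤ × ℤ × ℤ =>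
      (2 * (v.2.1 + v.2.2), v.1 + v.2.1 - v.2.2, -(v.1 - v.2.1 + v.2.2))) := by
    rintro ⟨x, y, z⟩ ⟨x', y', z'⟩ h
    simp only [Prod.mk.injEq] at h ⊢
    omega
  have hodd : ∀ v ∈ S, v.1 % 2 = 1 ∧ (v.2.1 + v.2.2) % 2 = 0 := by
    rintro ⟨x, y, z⟩ h
    simp only [hS, tVal, Set.mem_ofPred_eq] at h ⊢
    have hx := sq4 x
    have hy := sq4 y
    have hz := sq4 z
    split_ifs at hx hy hz <;> omega
  have hU : {v : ℤ × ℤ × ℤ | tVal 1 2 2 v = 4 * m} =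
      ((fun v : ℤ × ℤ × ℤ => (2 * v.1, 2 * v.2.1, 2 * v.2.2)) '' S) ∪
      (((fun v : ℤ × ℤ × ℤ =>
        (2 * (v.2.1 + v.2.2), v.1 + v.2.1 - v.2.2, v.1 - v.2.1 + v.2.2)) '' S) ∪
      ((fun v : ℤ × ℤ × ℤ =>
        (2 * (v.2.1 + v.2.2), v.1 + v.2.1 - v.2.2, -(v.1 - v.2.1 + v.2.2))) '' S)) := by
    ext ⟨x, y, z⟩
    simp only [hS, tVal, Set.mem_ofPred_eq, Set.mem_union, Set.mem_image, Prod.mk.injEq,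
      Prod.exists]
    constructor
    · intro h
      obtain ⟨a, rfl⟩ := even_of_sq_add_two_mul (x := x) (y := y) (z := z) (m := m)
        (by linear_combination h)
      have ha := sq4 a
      have hy := sq4 y
      have hz := sq4 z
      have h2 : 2 * a ^ 2 + y ^ 2 + z ^ 2 = 2 * m := by linarith
      by_cases hye : y % 2 = 0
      · have hze : z % 2 = 0 := by
          by_contra hne
          rw [if_pos hye] at hy
          rw [if_neg hne] at hz
          omega
        obtain ⟨u, rfl⟩ := Int.dvd_of_emod_eq_zero hye
        obtain ⟨w, rfl⟩ := Int.dvd_of_emod_eq_zero hze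
        exact Or.inl ⟨a, u, w, by linarith, by ring, rfl, rfl⟩
      · right
        rw [if_neg hye] at hy
        have hzo : ¬ z % 2 = 0 := by
          intro hne
          rw [if_pos hne] at hz
          omega
        rw [if_neg hzo] at hz
        have hae : a % 2 = 0 := by
          by_contra hne
          rw [if_neg hne] at ha
          omega
        by_cases h4 : (y + z) % 4 = 2
        · left
          obtain ⟨s, hs⟩ : ∃ s, y + z = 2 * s := ⟨(y + z) / 2, by omega⟩
          obtain ⟨u, hu⟩ : ∃ u, 2 * a + y - z = 4 * u := ⟨(2 * a + y - z) / 4, by omega⟩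
          obtain rfl : a = 2 * u - (y - s) := by omega
          obtain rfl : z = 2 * s - y := by omega
          refine ⟨s, u, u - (y - s), by linarith, by ring, by ring, by ring⟩
        · right
          obtain ⟨s, hs⟩ : ∃ s, y - z = 2 * s := ⟨(y - z) / 2, by omega⟩
          obtain ⟨u, hu⟩ : ∃ u, 2 * a + y + z = 4 * u := ⟨(2 * a + y + z) / 4, by omega⟩
          obtain rfl : a = 2 * u - (y - s) := by omega
          obtain rfl : z = y - 2 * s := by omega
          refine ⟨s, u, u - (y - s), by linarith, by ring, by ring, by ring⟩
    · rintro (⟨a, b, c, h, rfl, rfl, rfl⟩ | ⟨a, b, c, h, rfl, rfl, rfl⟩ |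
        ⟨a, b, c, h, rfl, rfl, rfl⟩) <;> linarith
  have hfinU := hfin
  rw [hU] at hfinU
  have hf₁ := hfinU.subset Set.subset_union_left
  have hf₂₃ := hfinU.subset Set.subset_union_right
  have hf₂ := hf₂₃.subset Set.subset_union_left
  have hf₃ := hf₂₃.subset Set.subset_union_right
  rw [tRep, tRep, hU, Set.ncard_union_eq _ hf₁ hf₂₃, Set.ncard_union_eq _ hf₂ hf₃,
    Set.ncard_image_of_injective _ hinj₁, Set.ncard_image_of_injective _ hinj₂,
    Set.ncard_image_of_injective _ hinj₃]
  · ring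
  · rw [Set.disjoint_left]
    rintro _ ⟨v, hv, rfl⟩ ⟨w, hw, h⟩
    have h1 := hodd v hv
    have h2 := hodd w hw
    simp only [Prod.mk.injEq] at h
    omega
  · rw [Set.disjoint_left]
    rintro _ ⟨v, hv, rfl⟩ (⟨w, hw, h⟩ | ⟨w, hw, h⟩) <;>
    · have h1 := hodd v hv
      have h2 := hodd w hw
      simp only [Prod.mk.injEq] at h
      omega

theorem tRep_two_pow_mul_sq {n : ℕ} (hn : Odd n) (t : ℕ) :
    tRep 1 2 2 (((2 : ℤ) ^ (t + 1) * n) ^ 2) = 3 * tRep 1 2 2 ((n : ℤ) ^ 2) := by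
  induction t with
  | zero =>
    have h : ((n : ℤ) ^ 2) % 4 = 1 := by
      obtain ⟨k, rfl⟩ := hn
      push_cast
      ring_nf
      omega
    rw [← tRep_four_mul h]
    congr 1
    ring
  | succ t ih =>
    rw [← ih, show ((2 : ℤ) ^ (t + 1) * n) ^ 2 = 4 * (2 ^ t * n) ^ 2 by ring,
      ← tRep_sixteen_mul]
    congr 1
    ring

/-- The ternary form `x² + 2y² + 2z²`-type form `⟨1,2,2⟩` is strongly s-regular. -/
theorem stmt_17 (n₁ n₂ : ℕ) (h₁ : 0 < n₁) (h₂ : 0 < n₂)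
    (hpow : ∃ t : ℕ, n₁ = 2 ^ t) (hodd : Odd n₂) :
    (tRep 1 2 2 (((n₁ : ℤ) * (n₂ : ℤ)) ^ 2) : ℤ) =
      (tRep 1 2 2 ((n₁ : ℤ) ^ 2) : ℤ) *
        ∏ p ∈ n₂.primeFactors, tHp 1 2 2 p (n₂.factorization p) := by
  rw [← chiSigma_eq_prod hodd]
  have hone : (tRep 1 2 2 (((1 : ℕ) : ℤ) ^ 2) : ℤ) = 2 := by
    rw [tRep_sq_of_odd odd_one, chiSigma_isMultiplicative.map_one, mul_one]
  obtain ⟨t, rfl⟩ := hpow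
  cases t with
  | zero =>
    rw [pow_zero, hone, Nat.cast_one, one_mul, tRep_sq_of_odd hodd]
  | succ t =>
    have h := tRep_two_pow_mul_sq odd_one t
    rw [Nat.cast_one, mul_one] at h
    rw [Nat.cast_one] at hone
    rw [Nat.cast_pow, Nat.cast_ofNat, tRep_two_pow_mul_sq hodd, h, Nat.cast_mul, Nat.cast_mul,
      hone, tRep_sq_of_odd hodd]
    ring
end

section
/- The ternary quadratic form x² + 3y² + 3z² is strongly s-regular: for every positive integer n = n₁n₂ with every prime factor of n₁ in {2, 3} and gcd(n₂, 6) = 1, r(n₁²n₂², f) = r(n₁², f) · ∏_{p | n₂} h_p(ord_p(n₂)). -/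
open Finset

open scoped Quaternion

/-- The order `ℤ⟨1, i, j, k⟩` with `i² = -1`, `j² = -3`. -/
abbrev SubOrder : Type := ℍ[ℤ,-1,-3]

/-- The order `ℤ[ω] + ℤ[ω]j` with `ω² = -1 - ω`, `j² = -1`, a maximal order of the rational
quaternion algebra of discriminant `3`. -/
abbrev MaxOrder : Type := ℍ[ℤ,-1,-1,-1]

namespace MaxOrder

/-- The reduced norm. -/
def nrm (q : MaxOrder) : ℤ :=
  q.re ^ 2 - q.re * q.imI + q.imI ^ 2 + q.imJ ^ 2 - q.imJ * q.imK + q.imK ^ 2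

lemma mul_star (q : MaxOrder) : q * star q = (nrm q : ℤ) := by
  ext <;> simp <;> (try simp only [nrm]) <;> ring

lemma star_mul (q : MaxOrder) : star q * q = (nrm q : ℤ) := by
  ext <;> simp <;> (try simp only [nrm]) <;> ring

lemma nrm_mul (x y : MaxOrder) : nrm (x * y) = nrm x * nrm y := by
  simp [nrm]; ring

lemma nrm_star (x : MaxOrder) : nrm (star x) = nrm x := by
  simp [nrm]; ring

lemma nrm_nonneg (q : MaxOrder) : 0 ≤ nrm q := by
  simp only [nrm]
  nlinarith [sq_nonneg (q.re - q.imI), sq_nonneg q.re, sq_nonneg q.imI,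
    sq_nonneg (q.imJ - q.imK), sq_nonneg q.imJ, sq_nonneg q.imK]

lemma eq_zero_of_nrm {q : MaxOrder} (h : nrm q = 0) : q = 0 := by
  simp only [nrm] at h
  have h1 : q.re ^ 2 = 0 := by
    nlinarith [sq_nonneg (q.re - q.imI), sq_nonneg q.re, sq_nonneg q.imI,
      sq_nonneg (q.imJ - q.imK), sq_nonneg q.imJ, sq_nonneg q.imK]
  have h2 : q.imI ^ 2 = 0 := by
    nlinarith [sq_nonneg (q.re - q.imI), sq_nonneg q.re, sq_nonneg q.imI,
      sq_nonneg (q.imJ - q.imK), sq_nonneg q.imJ, sq_nonneg q.imK]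
  have h3 : q.imJ ^ 2 = 0 := by
    nlinarith [sq_nonneg (q.re - q.imI), sq_nonneg q.re, sq_nonneg q.imI,
      sq_nonneg (q.imJ - q.imK), sq_nonneg q.imJ, sq_nonneg q.imK]
  have h4 : q.imK ^ 2 = 0 := by
    nlinarith [sq_nonneg (q.re - q.imI), sq_nonneg q.re, sq_nonneg q.imI,
      sq_nonneg (q.imJ - q.imK), sq_nonneg q.imJ, sq_nonneg q.imK]
  ext
  · simpa using h1
  · simpa using h2
  · simpa using h3
  · simpa using h4

/-- Rounding in the hexagonal lattice. -/
lemma exists_hex_round (x y : ℤ) {M : ℤ} (hM : 0 < M) :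
    ∃ s t : ℤ, 2 * ((x - M * s) ^ 2 - (x - M * s) * (y - M * t) + (y - M * t) ^ 2) < M ^ 2 := by
  have key : ∀ z : ℤ, ∀ K : ℤ, 0 < K → ∃ s : ℤ, 2 * |z - K * s| ≤ K := by
    intro z K hK
    refine ⟨(2 * z + K) / (2 * K), ?_⟩
    have h1 := Int.mul_ediv_add_emod (2 * z + K) (2 * K)
    have h2 := Int.emod_nonneg (2 * z + K) (by omega : 2 * K ≠ 0)
    have h3 := Int.emod_lt_of_pos (2 * z + K) (by omega : 0 < 2 * K)
    have : 2 * (z - K * ((2 * z + K) / (2 * K))) = (2 * z + K) % (2 * K) - K := by linarith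
    have h4 : |2 * (z - K * ((2 * z + K) / (2 * K)))| ≤ K := by
      rw [this, abs_le]
      constructor <;> linarith
    rwa [abs_mul, abs_two] at h4
  obtain ⟨t, ht⟩ := key y M hM
  obtain ⟨s, hs⟩ := key (2 * x - (y - M * t)) (2 * M) (by omega)
  refine ⟨s, t, ?_⟩
  set b := y - M * t
  have e : 2 * x - b - 2 * M * s = 2 * (x - M * s) - b := by ring
  rw [e] at hs
  set a := x - M * s
  have h1 : b ^ 2 * 4 ≤ M ^ 2 := by
    have := sq_abs b
    nlinarith [abs_nonneg b]
  have h2 : (2 * a - b) ^ 2 ≤ M ^ 2 := by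
    have := sq_abs (2 * a - b)
    nlinarith [abs_nonneg (2 * a - b)]
  nlinarith

lemma exists_nrm_sub_lt (a q : MaxOrder) (hq : q ≠ 0) : ∃ s, nrm (a - q * s) < nrm q := by
  have hM : 0 < nrm q := lt_of_le_of_ne (nrm_nonneg q) fun h => hq (eq_zero_of_nrm h.symm)
  set c := star q * a with hc
  obtain ⟨s, t, h1⟩ := exists_hex_round c.re c.imI hM
  obtain ⟨u, v, h2⟩ := exists_hex_round c.imJ c.imK hM
  refine ⟨⟨s, t, u, v⟩, ?_⟩
  have e : star q * (a - q * ⟨s, t, u, v⟩) = c - (nrm q : ℤ) * ⟨s, t, u, v⟩ := by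
    rw [mul_sub, ← mul_assoc, star_mul]
  have h3 : nrm q * nrm (a - q * ⟨s, t, u, v⟩) < nrm q * nrm q := by
    rw [← nrm_star q, ← nrm_mul, e, nrm_star]
    generalize nrm q = M at *
    simp only [nrm]
    simp
    linarith
  exact lt_of_mul_lt_mul_left h3 hM.le

/-- An element whose norm is divisible by `p`, but which is itself not divisible by `p`, has a left
factor of norm `p`. -/
lemma exists_left_factor {p : ℕ} (hp : p.Prime) {e : MaxOrder} (hN : (p : ℤ) ∣ nrm e)
    (hne : ¬ ((p : ℤ) : MaxOrder) ∣ e) : ∃ q g : MaxOrder, nrm q = p ∧ e = q * g := by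
  let I : Set MaxOrder := {q | q ≠ 0 ∧ ∃ x y : MaxOrder, q = e * x + ((p : ℤ) : MaxOrder) * y}
  have hp0 : ((p : ℤ) : MaxOrder) ≠ 0 := by
    intro h
    have := congrArg QuaternionAlgebra.re h
    simp [hp.ne_zero] at this
  have hI : I.Nonempty := ⟨((p : ℤ) : MaxOrder), hp0, 0, 1, by simp⟩
  obtain ⟨q, ⟨hq0, x, y, hq⟩, hmin⟩ :=
    (measure (fun q : MaxOrder => (nrm q).natAbs)).wf.has_min I hI
  have hdiv : ∀ c x' y' : MaxOrder, c = e * x' + ((p : ℤ) : MaxOrder) * y' → ∃ s, c = q * s := by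
    intro c x' y' hc
    obtain ⟨s, hs⟩ := exists_nrm_sub_lt c q hq0
    refine ⟨s, ?_⟩
    by_contra hcs
    refine hmin (c - q * s) ⟨sub_ne_zero.2 hcs, x' - x * s, y' - y * s, ?_⟩ ?_
    · rw [hc, hq]; noncomm_ring
    · have := nrm_nonneg (c - q * s)
      change (nrm (c - q * s)).natAbs < (nrm q).natAbs
      omega
  obtain ⟨s, hs⟩ := hdiv _ 0 1 (by simp : ((p : ℤ) : MaxOrder) = _)
  obtain ⟨g, hg⟩ := hdiv e 1 0 (by simp)
  refine ⟨q, g, ?_, hg⟩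
  have hpq : (p : ℤ) ∣ nrm q := by
    obtain ⟨k, hk⟩ := hN
    have h1 : nrm (e * x) = p * (k * nrm x) := by rw [nrm_mul, hk]; ring
    have h2 : nrm q = nrm (e * x) + p * (2 * (e * x).re * y.re - (e * x).re * y.imI
      - (e * x).imI * y.re + 2 * (e * x).imI * y.imI + 2 * (e * x).imJ * y.imJ
      - (e * x).imJ * y.imK - (e * x).imK * y.imJ + 2 * (e * x).imK * y.imK + p * nrm y) := by
      rw [hq]
      generalize e * x = u
      simp [nrm]
      ring
    rw [h2, h1, ← mul_add]
    exact dvd_mul_right _ _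
  have hprod : nrm q * nrm s = p ^ 2 := by
    rw [← nrm_mul, ← hs]; simp [nrm]
  have hdvd : (nrm q).natAbs ∣ p ^ 2 := by
    rw [← Int.natCast_dvd_natCast, Int.natAbs_of_nonneg (nrm_nonneg q)]
    exact ⟨nrm s, by rw [hprod]; push_cast; rfl⟩
  obtain ⟨i, hi, hqi⟩ := (Nat.dvd_prime_pow hp).1 hdvd
  have hqi' : nrm q = p ^ i := by
    rw [← Int.natAbs_of_nonneg (nrm_nonneg q), hqi]; push_cast; rfl
  have hp2 := hp.two_le
  interval_cases i
  · exfalso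
    rw [hqi', pow_zero] at hpq
    have := Int.le_of_dvd one_pos hpq
    omega
  · simpa using hqi'
  · exfalso
    have hs1 : nrm s = 1 := by
      rw [hqi'] at hprod
      have : (p : ℤ) ^ 2 ≠ 0 := by positivity
      exact mul_left_cancel₀ this (by rw [hprod, mul_one])
    apply hne
    refine ⟨star s * g, ?_⟩
    rw [hs, ← mul_assoc, mul_assoc q, mul_star, hs1, hg]
    simp

end MaxOrder

namespace SubOrder

/-- The reduced norm. -/
def nrm (q : SubOrder) : ℤ := q.re ^ 2 + q.imI ^ 2 + 3 * q.imJ ^ 2 + 3 * q.imK ^ 2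

lemma mul_star (q : SubOrder) : q * star q = nrm q • (1 : SubOrder) := by
  ext <;> simp <;> (try simp only [nrm]) <;> ring

lemma star_mul (q : SubOrder) : star q * q = nrm q • (1 : SubOrder) := by
  ext <;> simp <;> (try simp only [nrm]) <;> ring

lemma add_star (x : SubOrder) : x + star x = (2 * x.re) • (1 : SubOrder) := by
  ext <;> simp [two_mul, -zsmul_eq_mul]

lemma nrm_mul (x y : SubOrder) : nrm (x * y) = nrm x * nrm y := by
  simp [nrm]; ring

lemma nrm_star (x : SubOrder) : nrm (star x) = nrm x := by
  simp [nrm]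

lemma mul_mul_self (x y : SubOrder) :
    x * y * x = (2 * (x * y).re) • x - nrm x • star y := by
  ext <;> simp [-zsmul_eq_mul, nrm] <;> ring

lemma re_mul_comm (x y : SubOrder) : (x * y).re = (y * x).re := by
  simp; ring

lemma smul_cancel {m : ℤ} (hm : m ≠ 0) {x y : SubOrder} (h : m • x = m • y) : x = y := by
  have h1 := congrArg QuaternionAlgebra.re h
  have h2 := congrArg QuaternionAlgebra.imI h
  have h3 := congrArg QuaternionAlgebra.imJ h
  have h4 := congrArg QuaternionAlgebra.imK h
  simp [hm] at h1 h2 h3 h4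
  ext <;> assumption

/-- Divisibility of a quaternion by an integer. -/
def DivBy (m : ℤ) (x : SubOrder) : Prop := ∃ y, x = m • y

namespace DivBy

variable {m : ℤ} {x y : SubOrder}

lemma add (hx : DivBy m x) (hy : DivBy m y) : DivBy m (x + y) := by
  obtain ⟨a, rfl⟩ := hx
  obtain ⟨b, rfl⟩ := hy
  exact ⟨a + b, by rw [smul_add]⟩

lemma neg (hx : DivBy m x) : DivBy m (-x) := by
  obtain ⟨a, rfl⟩ := hx
  exact ⟨-a, by rw [smul_neg]⟩

lemma sub (hx : DivBy m x) (hy : DivBy m y) : DivBy m (x - y) := by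
  rw [sub_eq_add_neg]; exact hx.add hy.neg

lemma mul_left (z : SubOrder) (hx : DivBy m x) : DivBy m (z * x) := by
  obtain ⟨a, rfl⟩ := hx
  exact ⟨z * a, by rw [mul_smul_comm]⟩

lemma mul_right (z : SubOrder) (hx : DivBy m x) : DivBy m (x * z) := by
  obtain ⟨a, rfl⟩ := hx
  exact ⟨a * z, by rw [smul_mul_assoc]⟩

lemma star (hx : DivBy m x) : DivBy m (star x) := by
  obtain ⟨a, rfl⟩ := hx
  exact ⟨Star.star a, by rw [star_smul, star_trivial]⟩

lemma smul_of_dvd {t : ℤ} (h : m ∣ t) (x : SubOrder) : DivBy m (t • x) := by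
  obtain ⟨k, rfl⟩ := h
  exact ⟨k • x, by rw [mul_smul]⟩

end DivBy

lemma divBy_iff {m : ℤ} {x : SubOrder} :
    DivBy m x ↔ m ∣ x.re ∧ m ∣ x.imI ∧ m ∣ x.imJ ∧ m ∣ x.imK := by
  constructor
  · rintro ⟨y, rfl⟩
    simp
  · rintro ⟨⟨a, ha⟩, ⟨b, hb⟩, ⟨c, hc⟩, ⟨d, hd⟩⟩
    exact ⟨⟨a, b, c, d⟩, by ext <;> simp [*]⟩

lemma divBy_of_smul {p : ℤ} (hp : Prime p) {t : ℤ} (ht : ¬ p ∣ t) {x : SubOrder}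
    (h : DivBy p (t • x)) : DivBy p x := by
  rw [divBy_iff] at h ⊢
  simp only [QuaternionAlgebra.re_smul, QuaternionAlgebra.imI_smul, QuaternionAlgebra.imJ_smul,
    QuaternionAlgebra.imK_smul, smul_eq_mul, hp.dvd_mul, ht, false_or] at h
  exact h

/-- The embedding of the suborder into the maximal order. -/
def toMax (x : SubOrder) : MaxOrder :=
  ⟨x.re + x.imJ, 2 * x.imJ, x.imI - x.imK, -2 * x.imK⟩

lemma toMax_mul (x y : SubOrder) : toMax (x * y) = toMax x * toMax y := by
  ext <;> simp [toMax] <;> ring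

lemma toMax_star (x : SubOrder) : toMax (star x) = star (toMax x) := by
  ext <;> simp [toMax] <;> ring

lemma nrm_toMax (x : SubOrder) : (toMax x).nrm = nrm x := by
  simp [toMax, nrm, MaxOrder.nrm]; ring

lemma divBy_of_toMax {p : ℤ} (hp : Prime p) (h2 : ¬ p ∣ 2) {x : SubOrder}
    (h : (p : MaxOrder) ∣ toMax x) : DivBy p x := by
  obtain ⟨y, hy⟩ := h
  have h1 := congrArg QuaternionAlgebra.re hy
  have h2 := congrArg QuaternionAlgebra.imI hy
  have h3 := congrArg QuaternionAlgebra.imJ hy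
  have h4 := congrArg QuaternionAlgebra.imK hy
  simp [toMax] at h1 h2 h3 h4
  have hJ : p ∣ x.imJ := (hp.dvd_or_dvd ⟨_, h2⟩).resolve_left ‹_›
  have hK : p ∣ x.imK := (hp.dvd_or_dvd ⟨-y.imK, by linarith⟩ : p ∣ 2 ∨ _).resolve_left ‹_›
  refine divBy_iff.2 ⟨?_, ?_, hJ, hK⟩
  · exact (dvd_add_left hJ).1 ⟨_, h1⟩
  · exact (dvd_sub_left hK).1 ⟨_, h3⟩

/-- Every element of odd norm of the maximal order is right associated to one of the suborder. -/
lemma exists_toMax_eq_mul_unit (q : MaxOrder) (hq : Odd q.nrm) :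
    ∃ u : MaxOrder, u.nrm = 1 ∧ ∃ r : SubOrder, q * u = toMax r := by
  have lift : ∀ z : MaxOrder, Even z.imI → Even z.imK → ∃ r : SubOrder, z = toMax r := by
    rintro z ⟨s, hs⟩ ⟨w, hw⟩
    refine ⟨⟨z.re - s, z.imJ - w, s, -w⟩, ?_⟩
    ext <;> simp [toMax] <;> linarith
  have hpar : (Even q.imI ∧ Even q.imK) ∨ (Even (q.re - q.imI) ∧ Even q.imJ) ∨
      (Even q.re ∧ Even (q.imJ - q.imK)) := by
    rw [← Int.not_even_iff_odd] at hq
    simp only [MaxOrder.nrm, Int.even_add, Int.even_sub, Int.even_mul, Int.even_pow] at hq ⊢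
    tauto
  rcases hpar with ⟨h1, h2⟩ | ⟨h1, h2⟩ | ⟨h1, h2⟩
  · exact ⟨1, by simp [MaxOrder.nrm], lift _ (by simpa using h1) (by simpa using h2)⟩
  · refine ⟨⟨0, 1, 0, 0⟩, by simp [MaxOrder.nrm], lift _ ?_ ?_⟩
    · simpa [sub_eq_add_neg] using h1
    · simpa using h2
  · refine ⟨⟨-1, -1, 0, 0⟩, by simp [MaxOrder.nrm], lift _ ?_ ?_⟩
    · simp; simpa using h1
    · simp; rwa [← sub_eq_add_neg]

lemma exists_left_factor {p : ℕ} (hp : p.Prime) (hp2 : p ≠ 2) {e : SubOrder}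
    (hN : (p : ℤ) ∣ nrm e) (hne : ¬ DivBy p e) :
    ∃ q g : SubOrder, nrm q = p ∧ e = q * g := by
  have hpZ : Prime (p : ℤ) := Nat.prime_iff_prime_int.1 hp
  have h2 : ¬ (p : ℤ) ∣ 2 := by
    intro h
    have : p ∣ 2 := by exact_mod_cast h
    exact hp2 ((Nat.prime_dvd_prime_iff_eq hp Nat.prime_two).1 this)
  obtain ⟨q, g, hq, he⟩ := MaxOrder.exists_left_factor hp (e := toMax e)
    (by rwa [nrm_toMax]) (fun h => hne (divBy_of_toMax hpZ h2 h))
  have hodd : Odd q.nrm := by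
    rw [hq]; exact_mod_cast hp.odd_of_ne_two hp2
  obtain ⟨u, hu, r, hr⟩ := exists_toMax_eq_mul_unit q hodd
  have hrN : nrm r = p := by
    rw [← nrm_toMax, ← hr, MaxOrder.nrm_mul, hq, hu, mul_one]
  have hdiv : DivBy p (star r * e) := by
    refine divBy_of_toMax hpZ h2 ⟨star u * g, ?_⟩
    rw [toMax_mul, toMax_star, ← hr, he, StarMul.star_mul, mul_assoc, ← mul_assoc (star q),
      MaxOrder.star_mul, hq, ← mul_assoc, ← mul_assoc, Int.cast_comm]
  obtain ⟨g', hg'⟩ := hdiv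
  refine ⟨r, g', hrN, smul_cancel hpZ.ne_zero ?_⟩
  rw [← mul_smul_comm, ← hg', ← mul_assoc, mul_star, hrN, smul_mul_assoc, one_mul]

lemma exists_not_dvd_trace {p : ℤ} (hp : Prime p) (h2 : ¬ p ∣ 2) (h3 : ¬ p ∣ 3) {e : SubOrder}
    (he : e.re = 0) (hne : ¬ DivBy p e) : ∃ y : SubOrder, ¬ p ∣ 2 * (e * y).re := by
  by_contra! h
  apply hne
  have hi := h ⟨0, 1, 0, 0⟩
  have hj := h ⟨0, 0, 1, 0⟩
  have hk := h ⟨0, 0, 0, 1⟩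
  simp [hp.dvd_mul, h2, h3] at hi hj hk
  exact divBy_iff.2 ⟨by simp [he], hi, hj, hk⟩

section Neighbour

variable {p : ℤ} {q g e : SubOrder}

lemma star_eq_neg_of_re {x : SubOrder} (hx : x.re = 0) : star x = -x :=
  QuaternionAlgebra.star_eq_neg.2 hx

lemma divBy_smul_sub (hq : nrm q = p) (he : e = q * g) (y : SubOrder) :
    DivBy p ((2 * (e * y).re) • q - e * y * q) := by
  refine ⟨star (g * y), ?_⟩
  rw [he, mul_assoc q, mul_mul_self q, hq]
  abel

lemma sandwich_cancel (hp0 : p ≠ 0) (hq : nrm q = p) {w w' : SubOrder}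
    (h : q * w * star q = q * w' * star q) : w = w' := by
  have h1 : star q * (q * w * star q) * q = star q * (q * w' * star q) * q := by rw [h]
  have h2 : ∀ w : SubOrder, star q * (q * w * star q) * q = p • p • w := by
    intro w
    rw [show star q * (q * w * star q) * q = (star q * q) * w * (star q * q) by noncomm_ring,
      star_mul, hq]
    simp only [smul_mul_assoc, mul_smul_comm, mul_one, one_mul]
  rw [h2, h2] at h1
  exact smul_cancel hp0 (smul_cancel hp0 h1)

lemma nrm_sandwich (hq : nrm q = p) (w : SubOrder) :
    nrm (q * w * star q) = p ^ 2 * nrm w := by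
  rw [nrm_mul, nrm_mul, nrm_star, hq]; ring

lemma re_sandwich (q w : SubOrder) : (q * w * star q).re = nrm q * w.re := by
  simp [nrm]; ring

lemma dvd_nrm (hq : nrm q = p) (he : e = q * g) : p ∣ nrm e :=
  ⟨nrm g, by rw [he, nrm_mul, hq]⟩

/-- Primitive vectors in the image of the similitude attached to a left factor of `e`. -/
lemma exists_sandwich_iff (hp : Prime p) (h2 : ¬ p ∣ 2) (h3 : ¬ p ∣ 3) (hq : nrm q = p)
    (he : e = q * g) (hre : e.re = 0) (hne : ¬ DivBy p e) {u : SubOrder} (hu : u.re = 0)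
    (hnu : ¬ DivBy p u) (hN : p ^ 2 ∣ nrm u) :
    (∃ w, u = q * w * star q) ↔ DivBy p (u * e) := by
  constructor
  · rintro ⟨w, rfl⟩
    refine ⟨q * w * g, ?_⟩
    rw [he, show q * w * star q * (q * g) = q * w * (star q * q) * g by noncomm_ring, star_mul, hq]
    simp only [smul_mul_assoc, mul_smul_comm, mul_one]
  · intro h
    obtain ⟨y, hy⟩ := exists_not_dvd_trace hp h2 h3 hre hne
    have heu : DivBy p (e * u) := by
      have := h.star
      rwa [StarMul.star_mul, star_eq_neg_of_re hu, star_eq_neg_of_re hre, neg_mul_neg] at this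
    have hqu : DivBy p (star q * u) := by
      refine divBy_of_smul hp hy ?_
      have h1 := ((divBy_smul_sub hq he y).star.mul_right u).sub ((heu.mul_left (star q * star y)))
      convert h1 using 1
      rw [star_sub, StarMul.star_mul, StarMul.star_mul, star_eq_neg_of_re hre, star_smul]
      simp only [sub_mul, smul_mul_assoc, mul_neg, neg_mul, mul_assoc, star_trivial]
      abel
    obtain ⟨s, hs⟩ := hqu
    have hus : u = q * s := by
      apply smul_cancel hp.ne_zero
      rw [← mul_smul_comm, ← hs, ← mul_assoc, mul_star, hq, smul_mul_assoc, one_mul]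
    have hsN : p ∣ nrm s := by
      rw [hus, nrm_mul, hq, pow_two] at hN
      exact (mul_dvd_mul_iff_left hp.ne_zero).1 hN
    have hsqs : DivBy p (s * q * s) := by
      rw [mul_mul_self, re_mul_comm, ← hus, hu, mul_zero, zero_smul]
      rw [zero_sub]
      exact (DivBy.smul_of_dvd hsN _).neg
    have hT : ∀ y, DivBy p (s * q * y * u) := by
      intro y
      have h1 : s * q * y * u = (2 * (q * y).re) • (s * q * s) - p • (s * star y * s) := by
        rw [hus, show s * q * y * (q * s) = s * (q * y * q) * s by noncomm_ring, mul_mul_self q, hq]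
        simp only [mul_sub, sub_mul, mul_smul_comm, smul_mul_assoc]
      rw [h1]
      refine DivBy.sub ?_ ⟨_, rfl⟩
      obtain ⟨c, hc⟩ := hsqs
      exact ⟨(2 * (q * y).re) • c, by rw [hc, smul_comm]⟩
    obtain ⟨z, hz⟩ := exists_not_dvd_trace hp h2 h3 hu hnu
    have hsq : DivBy p (s * q) := by
      refine divBy_of_smul hp hz ?_
      have h1 : (2 * (u * z).re) • (1 : SubOrder) = u * z - star z * u := by
        rw [← add_star, StarMul.star_mul, star_eq_neg_of_re hu, mul_neg, sub_eq_add_neg]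
      have h4 := ((hT 1).mul_right z).sub (hT (star z))
      convert h4 using 1
      rw [← mul_one (s * q), ← mul_smul_comm, h1]
      noncomm_ring
    obtain ⟨w, hw⟩ := hsq
    refine ⟨w, smul_cancel hp.ne_zero ?_⟩
    rw [← smul_mul_assoc, ← mul_smul_comm, ← hw, hus,
      show q * (s * q) * star q = q * s * (q * star q) by noncomm_ring, mul_star, hq]
    simp only [mul_smul_comm, mul_one]

/-- Multiples of `p` in the image of the similitude attached to a left factor of `e`. -/
lemma exists_smul_sandwich_iff (hp : Prime p) (h2 : ¬ p ∣ 2) (h3 : ¬ p ∣ 3) (hq : nrm q = p)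
    (he : e = q * g) (hre : e.re = 0) (hne : ¬ DivBy p e) (v : SubOrder) :
    (∃ w, p • v = q * w * star q) ↔ p ∣ (e * v).re := by
  have hstar : star e = -e := star_eq_neg_of_re hre
  have hev : e * v * e = -(star g * (star q * v * q) * g) := by
    nth_rewrite 1 [← neg_neg e]
    rw [← hstar, he, StarMul.star_mul]
    noncomm_ring
  have h1 : (∃ w, p • v = q * w * star q) ↔ DivBy p (star q * v * q) := by
    constructor
    · rintro ⟨w, hw⟩
      refine ⟨w, smul_cancel hp.ne_zero ?_⟩
      rw [← smul_mul_assoc, ← mul_smul_comm, hw,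
        show star q * (q * w * star q) * q = (star q * q) * w * (star q * q) by noncomm_ring,
        star_mul, hq]
      simp only [smul_mul_assoc, mul_smul_comm, mul_one, one_mul]
    · rintro ⟨w, hw⟩
      refine ⟨w, smul_cancel hp.ne_zero ?_⟩
      rw [← smul_mul_assoc, ← mul_smul_comm, ← hw,
        show q * (star q * v * q) * star q = (q * star q) * v * (q * star q) by noncomm_ring,
        mul_star, hq]
      simp only [smul_mul_assoc, mul_smul_comm, mul_one, one_mul]
  rw [h1]
  constructor
  · intro h
    have h4 : DivBy p ((2 * (e * v).re) • e) := by
      have h5 : DivBy p (e * v * e) := by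
        rw [hev]; exact ((h.mul_left _).mul_right _).neg
      have h6 := h5.add (DivBy.smul_of_dvd (dvd_nrm hq he) (star v))
      rwa [mul_mul_self, sub_add_cancel] at h6
    by_contra h7
    exact hne (divBy_of_smul hp (fun h8 => (hp.dvd_or_dvd h8).elim h2 h7) h4)
  · intro h
    have h5 : DivBy p (e * v * e) := by
      rw [mul_mul_self]
      exact (DivBy.smul_of_dvd (h.mul_left _) _).sub (DivBy.smul_of_dvd (dvd_nrm hq he) _)
    obtain ⟨y, hy⟩ := exists_not_dvd_trace hp h2 h3 hre hne
    have h6 := divBy_smul_sub hq he y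
    set t := 2 * (e * y).re
    refine divBy_of_smul hp hy (divBy_of_smul hp hy ?_)
    have h7 := ((h6.mul_left (t • (star q * v))).add (h6.star.mul_right (v * (e * y * q)))).sub
      ((h5.mul_left (star q * star y)).mul_right (y * q))
    convert h7 using 1
    rw [star_sub, StarMul.star_mul, StarMul.star_mul, hstar, star_smul]
    simp only [sub_mul, mul_sub, smul_mul_assoc, mul_smul_comm, mul_neg, neg_mul, mul_assoc,
      star_trivial]
    abel

end Neighbour

end SubOrder

namespace TernaryForm

section FiniteField

variable {p : ℕ} [Fact p.Prime]

/-- The form `x² + 3y² + 3z²` over `ZMod p`. -/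
def qf (v : ZMod p × ZMod p × ZMod p) : ZMod p := v.1 ^ 2 + 3 * v.2.1 ^ 2 + 3 * v.2.2 ^ 2

/-- The bilinear form attached to `x² + 3y² + 3z²` over `ZMod p`. -/
def bf (v w : ZMod p × ZMod p × ZMod p) : ZMod p :=
  v.1 * w.1 + 3 * (v.2.1 * w.2.1) + 3 * (v.2.2 * w.2.2)

/-- The nonzero isotropic vectors of `x² + 3y² + 3z²` over `ZMod p`. -/
def isoVecs (p : ℕ) [Fact p.Prime] : Finset (ZMod p × ZMod p × ZMod p) :=
  univ.filter fun v => v ≠ 0 ∧ qf v = 0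

lemma mem_isoVecs {v : ZMod p × ZMod p × ZMod p} : v ∈ isoVecs p ↔ v ≠ 0 ∧ qf v = 0 := by
  rw [isoVecs, mem_filter]
  exact and_iff_right (mem_univ _)

/-- The number of nonzero isotropic vectors orthogonal to a given vector. -/
def orthCount (v : ZMod p × ZMod p × ZMod p) : ℕ := #{e ∈ isoVecs p | bf v e = 0}

lemma two_ne_zero_zmod (h2 : p ≠ 2) : (2 : ZMod p) ≠ 0 := by
  have := (ZMod.natCast_eq_zero_iff 2 p).not.2 fun h =>
    h2 ((Nat.prime_dvd_prime_iff_eq Fact.out Nat.prime_two).1 h)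
  exact_mod_cast this

lemma three_ne_zero_zmod (h3 : p ≠ 3) : (3 : ZMod p) ≠ 0 := by
  have := (ZMod.natCast_eq_zero_iff 3 p).not.2 fun h =>
    h3 ((Nat.prime_dvd_prime_iff_eq Fact.out Nat.prime_three).1 h)
  exact_mod_cast this

lemma sum_quadraticChar_sq_add_sq (h2 : p ≠ 2) :
    ∑ w : ZMod p × ZMod p, quadraticChar (ZMod p) (w.1 ^ 2 + w.2 ^ 2) = 0 := by
  have hchar : ringChar (ZMod p) ≠ 2 := by rwa [ZMod.ringChar_zmod_n]
  obtain ⟨g, hg⟩ := FiniteField.exists_nonsquare hchar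
  obtain ⟨a, b, hab⟩ := ZMod.sq_add_sq p g
  have hg0 : g ≠ 0 := by rintro rfl; exact hg ⟨0, by simp⟩
  have hab0 : a ^ 2 + b ^ 2 ≠ 0 := by rwa [hab]
  let σ : ZMod p × ZMod p ≃ ZMod p × ZMod p :=
    { toFun := fun w => (a * w.1 - b * w.2, a * w.2 + b * w.1)
      invFun := fun w =>
        ((a * w.1 + b * w.2) / (a ^ 2 + b ^ 2), (a * w.2 - b * w.1) / (a ^ 2 + b ^ 2))
      left_inv := fun w => by
        ext <;> simp <;> field_simp <;> ring
      right_inv := fun w => by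
        ext <;> simp <;> field_simp <;> ring }
  have h1 := Equiv.sum_comp σ fun w => quadraticChar (ZMod p) (w.1 ^ 2 + w.2 ^ 2)
  have h3 : ∀ w, quadraticChar (ZMod p) ((σ w).1 ^ 2 + (σ w).2 ^ 2) =
      - quadraticChar (ZMod p) (w.1 ^ 2 + w.2 ^ 2) := by
    intro w
    have h4 : (σ w).1 ^ 2 + (σ w).2 ^ 2 = g * (w.1 ^ 2 + w.2 ^ 2) := by
      rw [← hab]; simp [σ]; ring
    rw [h4, map_mul, quadraticChar_neg_one_iff_not_isSquare.2 hg, neg_one_mul]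
  simp only [h3, sum_neg_distrib] at h1
  linarith

lemma card_isoVecs (h2 : p ≠ 2) : (#(isoVecs p) : ℤ) = p ^ 2 - 1 := by
  have hchar : ringChar (ZMod p) ≠ 2 := by rwa [ZMod.ringChar_zmod_n]
  have h0 : isoVecs p = (univ.filter fun v : ZMod p × ZMod p × ZMod p => qf v = 0).erase 0 := by
    ext v; simp [isoVecs]
  have hmem : (0 : ZMod p × ZMod p × ZMod p) ∈
      univ.filter fun v : ZMod p × ZMod p × ZMod p => qf v = 0 :=
    mem_filter.2 ⟨mem_univ _, by simp [qf]⟩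
  have h1 : #(univ.filter fun v : ZMod p × ZMod p × ZMod p => qf v = 0) =
      ∑ w : ZMod p × ZMod p, #{x : ZMod p | x ^ 2 = -3 * (w.1 ^ 2 + w.2 ^ 2)} := by
    rw [card_filter, Fintype.sum_prod_type_right]
    refine sum_congr rfl fun w _ => ?_
    rw [card_filter]
    refine sum_congr rfl fun x _ => ?_
    congr 1
    simp only [qf, eq_iff_iff]
    constructor <;> intro h <;> linear_combination h
  have h3 : ∀ c : ZMod p, (#{x : ZMod p | x ^ 2 = c} : ℤ) = quadraticChar (ZMod p) c + 1 := by
    intro c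
    rw [← quadraticChar_card_sqrts hchar c]
    congr 2
    ext; simp
  rw [h0, card_erase_of_mem hmem, Nat.cast_sub, h1]
  · push_cast
    simp only [h3, map_mul, sum_add_distrib, ← mul_sum, sum_quadraticChar_sq_add_sq h2]
    simp [ZMod.card, pow_two]
  · exact card_pos.2 ⟨0, hmem⟩

/-- Orthogonal isotropic vectors are proportional. -/
lemma cross_eq_zero (h3 : p ≠ 3) {u e : ZMod p × ZMod p × ZMod p} (hu : qf u = 0) (he : qf e = 0)
    (h : bf u e = 0) :
    u.1 * e.2.1 = u.2.1 * e.1 ∧ u.1 * e.2.2 = u.2.2 * e.1 ∧ u.2.1 * e.2.2 = u.2.2 * e.2.1 := by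
  have t := three_ne_zero_zmod h3
  obtain ⟨x, y, z⟩ := u
  obtain ⟨x', y', z'⟩ := e
  simp only [qf, bf] at *
  refine ⟨sub_eq_zero.1 (pow_eq_zero_iff two_ne_zero |>.1 ?_),
    sub_eq_zero.1 (pow_eq_zero_iff two_ne_zero |>.1 ?_),
    sub_eq_zero.1 (pow_eq_zero_iff two_ne_zero |>.1 ?_)⟩ <;>
  refine (mul_eq_zero.1 (?_ : (3 : ZMod p) * _ = 0)).resolve_left t
  · linear_combination (x' ^ 2 + 3 * y' ^ 2) * hu - 3 * z ^ 2 * he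
      - (x * x' + 3 * (y * y') - 3 * (z * z')) * h
  · linear_combination (x' ^ 2 + 3 * z' ^ 2) * hu - 3 * y ^ 2 * he
      - (x * x' + 3 * (z * z') - 3 * (y * y')) * h
  · refine (mul_eq_zero.1 (?_ : (3 : ZMod p) * _ = 0)).resolve_left t
    linear_combination (3 * y' ^ 2 + 3 * z' ^ 2) * hu - x ^ 2 * he
      - (3 * (y * y') + 3 * (z * z') - x * x') * h

lemma orthCount_zero (h2 : p ≠ 2) :
    (orthCount (0 : ZMod p × ZMod p × ZMod p) : ℤ) = p ^ 2 - 1 := by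
  rw [← card_isoVecs h2, orthCount, filter_true_of_mem]
  simp [bf]

lemma card_filter_ne_zero : #{c : ZMod p | c ≠ 0} = p - 1 := by
  rw [filter_ne' univ, card_erase_of_mem (mem_univ _), card_univ, ZMod.card]

lemma orthCount_of_isotropic (h3 : p ≠ 3) {u : ZMod p × ZMod p × ZMod p} (hu0 : u ≠ 0)
    (hu : qf u = 0) : orthCount u = p - 1 := by
  rw [← card_filter_ne_zero (p := p), orthCount]
  symm
  refine card_bij (fun c _ => c • u) ?_ ?_ ?_
  · intro c hc
    simp only [mem_filter, mem_isoVecs, mem_univ, true_and] at hc ⊢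
    refine ⟨⟨smul_ne_zero hc hu0, ?_⟩, ?_⟩ <;> simp only [qf, bf] at * <;> simp
    · linear_combination c ^ 2 * hu
    · linear_combination c * hu
  · intro c _ d _ h
    exact smul_left_injective _ hu0 h
  · intro e he
    simp only [mem_filter, mem_isoVecs] at he
    obtain ⟨⟨he0, he1⟩, he2⟩ := he
    obtain ⟨h1, h4, h5⟩ := cross_eq_zero h3 hu he1 he2
    have : ∃ c : ZMod p, c • u = e := by
      obtain ⟨x, y, z⟩ := u
      obtain ⟨x', y', z'⟩ := e
      simp only at h1 h4 h5
      by_cases hx : x = 0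
      · by_cases hy : y = 0
        · have hz : z ≠ 0 := by
            rintro rfl
            exact hu0 (by simp [hx, hy])
          refine ⟨z' / z, ?_⟩
          ext <;> simp <;> field_simp <;> grind
        · refine ⟨y' / y, ?_⟩
          ext <;> simp <;> field_simp <;> grind
      · refine ⟨x' / x, ?_⟩
        ext <;> simp <;> field_simp <;> grind
    obtain ⟨c, rfl⟩ := this
    exact ⟨c, by simpa using fun h : c = 0 => he0 (by simp [h]), rfl⟩

/-- The reflection in an anisotropic vector. -/
def reflect (d e : ZMod p × ZMod p × ZMod p) : ZMod p × ZMod p × ZMod p :=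
  e - (2 * bf d e / qf d) • d

lemma bf_reflect {d : ZMod p × ZMod p × ZMod p} (hd : qf d ≠ 0) (u e : ZMod p × ZMod p × ZMod p) :
    bf (reflect d u) (reflect d e) = bf u e := by
  have h : bf (reflect d u) (reflect d e) = bf u e - 2 * bf d e * bf d u / qf d
      - 2 * bf d e * bf d u / qf d
      + (2 * bf d u / qf d) * (2 * bf d e / qf d) * qf d := by
    simp only [reflect]
    generalize hr : 2 * bf d u / qf d = r
    generalize hs : 2 * bf d e / qf d = s
    have e1 : 2 * bf d e * bf d u / qf d = r * bf d e := by rw [← hr]; ring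
    have e2 : r * bf d e = s * bf d u := by rw [← hr, ← hs]; ring
    rw [e1]
    nth_rewrite 2 [e2]
    simp only [bf, qf]; simp; ring
  rw [h]; field_simp; ring

lemma qf_eq_bf (e : ZMod p × ZMod p × ZMod p) : qf e = bf e e := by
  simp only [qf, bf]; ring

lemma reflect_reflect {d : ZMod p × ZMod p × ZMod p} (hd : qf d ≠ 0)
    (e : ZMod p × ZMod p × ZMod p) : reflect d (reflect d e) = e := by
  have h : bf d (reflect d e) = - bf d e := by
    have : bf d (reflect d e) = bf d e - (2 * bf d e / qf d) * qf d := by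
      simp only [reflect]
      generalize 2 * bf d e / qf d = r
      simp only [bf, qf]; simp; ring
    rw [this]; field_simp; ring
  rw [reflect, h, reflect]
  have : 2 * -bf d e / qf d = -(2 * bf d e / qf d) := by ring
  rw [this, neg_smul]
  abel

lemma reflect_zero (d : ZMod p × ZMod p × ZMod p) : reflect d 0 = 0 := by
  simp [reflect, bf]

lemma orthCount_reflect {d : ZMod p × ZMod p × ZMod p} (hd : qf d ≠ 0)
    (v : ZMod p × ZMod p × ZMod p) : orthCount (reflect d v) = orthCount v := by
  have hne : ∀ e : ZMod p × ZMod p × ZMod p, reflect d e ≠ 0 ↔ e ≠ 0 := by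
    intro e
    refine not_congr ⟨fun h => ?_, fun h => by rw [h, reflect_zero]⟩
    rw [← reflect_reflect hd e, h, reflect_zero]
  refine card_nbij' (reflect d) (reflect d) ?_ ?_ (fun e _ => reflect_reflect hd e)
    (fun e _ => reflect_reflect hd e)
  · intro e he
    simp only [coe_filter, mem_isoVecs, Set.mem_ofPred_eq] at he ⊢
    refine ⟨⟨(hne e).2 he.1.1, ?_⟩, ?_⟩
    · rw [qf_eq_bf, bf_reflect hd, ← qf_eq_bf, he.1.2]
    · rw [← reflect_reflect hd v, bf_reflect hd, he.2]
  · intro e he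
    simp only [coe_filter, mem_isoVecs, Set.mem_ofPred_eq] at he ⊢
    refine ⟨⟨(hne e).2 he.1.1, ?_⟩, ?_⟩
    · rw [qf_eq_bf, bf_reflect hd, ← qf_eq_bf, he.1.2]
    · rw [bf_reflect hd, he.2]

lemma orthCount_axis (h2 : p ≠ 2) (h3 : p ≠ 3) {m : ZMod p} (hm : m ≠ 0) :
    (orthCount (m, (0 : ZMod p), (0 : ZMod p)) : ℤ) =
      (p - 1) * (1 + quadraticChar (ZMod p) (-1)) := by
  have t := three_ne_zero_zmod h3
  have hchar : ringChar (ZMod p) ≠ 2 := by rwa [ZMod.ringChar_zmod_n]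
  have h : #(({c : ZMod p | c ≠ 0} : Finset (ZMod p)) ×ˢ
      ({x : ZMod p | x ^ 2 = -1} : Set (ZMod p)).toFinset) =
      orthCount (m, (0 : ZMod p), (0 : ZMod p)) := by
    refine card_nbij' (fun w => (0, w.2 * w.1, w.1)) (fun e => (e.2.2, e.2.1 / e.2.2)) ?_ ?_ ?_ ?_
    · rintro ⟨c, x⟩ h
      simp [mem_isoVecs] at h ⊢
      simp [qf, bf]
      refine ⟨fun _ => h.1, ?_⟩
      linear_combination 3 * c ^ 2 * h.2
    · rintro ⟨x, y, z⟩ h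
      simp [mem_isoVecs] at h ⊢
      simp [qf, bf, hm] at h
      obtain ⟨⟨h0, hq⟩, rfl⟩ := h
      have hyz : y ^ 2 + z ^ 2 = 0 := by
        refine (mul_eq_zero.1 (?_ : (3 : ZMod p) * _ = 0)).resolve_left t
        linear_combination hq
      have hz : z ≠ 0 := by
        rintro rfl
        simp at hyz
        exact h0 rfl hyz rfl
      refine ⟨hz, ?_⟩
      field_simp
      linear_combination hyz
    · rintro ⟨c, x⟩ h
      simp at h
      simp [h.1]
    · rintro ⟨x, y, z⟩ h
      simp [mem_isoVecs] at h ⊢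
      simp [qf, bf, hm] at h
      obtain ⟨⟨h0, hq⟩, rfl⟩ := h
      refine ⟨rfl, div_mul_cancel_of_imp ?_⟩
      rintro rfl
      simpa [t] using hq
  rw [← h, card_product, card_filter_ne_zero]
  push_cast [quadraticChar_card_sqrts hchar, (Fact.out : p.Prime).one_le]
  ring

lemma orthCount_of_sq (h2 : p ≠ 2) (h3 : p ≠ 3) {v : ZMod p × ZMod p × ZMod p} {m : ZMod p}
    (hm : m ≠ 0) (hv : qf v = m ^ 2) :
    (orthCount v : ℤ) = (p - 1) * (1 + quadraticChar (ZMod p) (-1)) := by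
  have key : ∀ m' : ZMod p, m' ≠ 0 → qf v = m' ^ 2 → qf (v - (m', 0, 0)) ≠ 0 →
      (orthCount v : ℤ) = (p - 1) * (1 + quadraticChar (ZMod p) (-1)) := by
    intro m' hm' hv' hd
    rw [← orthCount_axis h2 h3 hm', ← orthCount_reflect hd v]
    congr 2
    have h1 : 2 * bf (v - (m', 0, 0)) v = qf (v - (m', 0, 0)) := by
      simp only [qf, bf] at *
      simp
      linear_combination hv'
    rw [reflect, h1, div_self hd, one_smul, sub_sub_cancel]
  by_cases hd : qf (v - (m, 0, 0)) = 0
  · refine key (-m) (neg_ne_zero.2 hm) (by rw [hv]; ring) fun hd' => ?_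
    have h4 : (2 : ZMod p) * 2 * m ^ 2 = 0 := by
      simp only [qf] at *
      simp at hd hd'
      linear_combination hd + hd' - 2 * hv
    have t := two_ne_zero_zmod h2
    exact mul_ne_zero (mul_ne_zero t t) (pow_ne_zero 2 hm) h4
  · exact key m hm hv hd

end FiniteField

/-- The embedding of `ℤ³` as the pure quaternions. -/
def pureQuat (v : ℤ × ℤ × ℤ) : SubOrder := ⟨0, v.1, v.2.1, v.2.2⟩

/-- Reduction modulo `p`. -/
def red (p : ℕ) (v : ℤ × ℤ × ℤ) : ZMod p × ZMod p × ZMod p := (v.1, v.2.1, v.2.2)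

lemma pureQuat_injective : Function.Injective pureQuat := by
  rintro ⟨x, y, z⟩ ⟨x', y', z'⟩ h
  simpa [pureQuat] using h

lemma eq_pureQuat {w : SubOrder} (hw : w.re = 0) : w = pureQuat (w.imI, w.imJ, w.imK) := by
  ext <;> simp [pureQuat, hw]

lemma nrm_pureQuat (v : ℤ × ℤ × ℤ) : (pureQuat v).nrm = tVal 1 3 3 v := by
  simp [SubOrder.nrm, pureQuat, tVal]

lemma pureQuat_smul (m : ℤ) (v : ℤ × ℤ × ℤ) : pureQuat (m • v) = m • pureQuat v := by
  ext <;> simp [pureQuat]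

lemma tVal_smul (m : ℤ) (v : ℤ × ℤ × ℤ) : tVal 1 3 3 (m • v) = m ^ 2 * tVal 1 3 3 v := by
  simp [tVal]; ring

lemma qf_red (p : ℕ) [Fact p.Prime] (v : ℤ × ℤ × ℤ) :
    qf (red p v) = (tVal 1 3 3 v : ZMod p) := by
  simp [qf, red, tVal]

lemma bf_red (p : ℕ) [Fact p.Prime] (v w : ℤ × ℤ × ℤ) :
    bf (red p v) (red p w) = ((-(pureQuat w * pureQuat v).re : ℤ) : ZMod p) := by
  simp [bf, red, pureQuat]; ring

lemma red_eq_zero_iff (p : ℕ) (v : ℤ × ℤ × ℤ) :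
    red p v = 0 ↔ SubOrder.DivBy p (pureQuat v) := by
  simp [red, Prod.ext_iff, SubOrder.divBy_iff, pureQuat, ZMod.intCast_zmod_eq_zero_iff_dvd]

lemma red_surjective (p : ℕ) : Function.Surjective (red p) := by
  rintro ⟨x, y, z⟩
  obtain ⟨a, rfl⟩ := ZMod.intCast_surjective x
  obtain ⟨b, rfl⟩ := ZMod.intCast_surjective y
  obtain ⟨c, rfl⟩ := ZMod.intCast_surjective z
  exact ⟨(a, b, c), rfl⟩

lemma divBy_pureQuat_iff {m : ℤ} {v : ℤ × ℤ × ℤ} :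
    SubOrder.DivBy m (pureQuat v) ↔ ∃ w, v = m • w := by
  constructor
  · intro h
    obtain ⟨-, ⟨a, ha⟩, ⟨b, hb⟩, ⟨c, hc⟩⟩ := SubOrder.divBy_iff.1 h
    exact ⟨(a, b, c), by ext <;> simpa⟩
  · rintro ⟨w, rfl⟩
    exact ⟨pureQuat w, pureQuat_smul m w⟩

lemma finite_setOf_tVal (n : ℤ) : {v : ℤ × ℤ × ℤ | tVal 1 3 3 v = n}.Finite := by
  refine (Set.finite_Icc ((-n, -n, -n) : ℤ × ℤ × ℤ) (n, n, n)).subset ?_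
  rintro ⟨x, y, z⟩ h
  simp only [tVal, Set.mem_ofPred_eq] at h
  have key : ∀ t : ℤ, t ^ 2 ≤ n → -n ≤ t ∧ t ≤ n := fun t ht =>
    ⟨by nlinarith [Int.le_self_sq (-t)], (Int.le_self_sq t).trans ht⟩
  have hx := key x (by nlinarith [sq_nonneg y, sq_nonneg z])
  have hy := key y (by nlinarith [sq_nonneg x, sq_nonneg y, sq_nonneg z])
  have hz := key z (by nlinarith [sq_nonneg x, sq_nonneg y, sq_nonneg z])
  exact ⟨⟨hx.1, hy.1, hz.1⟩, ⟨hx.2, hy.2, hz.2⟩⟩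

/-- The set of representations of `n` by `x² + 3y² + 3z²`. -/
noncomputable def reps (n : ℤ) : Finset (ℤ × ℤ × ℤ) := (finite_setOf_tVal n).toFinset

lemma mem_reps {n : ℤ} {v : ℤ × ℤ × ℤ} : v ∈ reps n ↔ tVal 1 3 3 v = n := by
  simp [reps]

lemma tRep_eq_card_reps (n : ℤ) : tRep 1 3 3 n = #(reps n) := by
  rw [tRep, Set.ncard_eq_toFinset_card _ (finite_setOf_tVal n), reps]

section Prime

variable {p : ℕ} [Fact p.Prime]

lemma int_prime : Prime (p : ℤ) := Nat.prime_iff_prime_int.1 Fact.out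

lemma not_dvd_two (h2 : p ≠ 2) : ¬ (p : ℤ) ∣ 2 := by
  intro h
  exact h2 ((Nat.prime_dvd_prime_iff_eq Fact.out Nat.prime_two).1 (by exact_mod_cast h))

lemma not_dvd_three (h3 : p ≠ 3) : ¬ (p : ℤ) ∣ 3 := by
  intro h
  exact h3 ((Nat.prime_dvd_prime_iff_eq Fact.out Nat.prime_three).1 (by exact_mod_cast h))

lemma dvd_tVal_iff {v : ℤ × ℤ × ℤ} : (p : ℤ) ∣ tVal 1 3 3 v ↔ qf (red p v) = 0 := by
  rw [qf_red, ZMod.intCast_zmod_eq_zero_iff_dvd]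

/-- A choice, for every isotropic vector, of a quaternion of norm `p` dividing a lift of it on the
left. -/
lemma exists_left_factors (h2 : p ≠ 2) :
    ∃ (l : ZMod p × ZMod p × ZMod p → ℤ × ℤ × ℤ) (q g : ZMod p × ZMod p × ZMod p → SubOrder),
      ∀ e ∈ isoVecs p, red p (l e) = e ∧ (q e).nrm = p ∧ pureQuat (l e) = q e * g e := by
  have h : ∀ e : ZMod p × ZMod p × ZMod p, ∃ (l : ℤ × ℤ × ℤ) (q g : SubOrder),
      e ∈ isoVecs p → red p l = e ∧ q.nrm = p ∧ pureQuat l = q * g := by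
    intro e
    by_cases he : e ∈ isoVecs p
    · obtain ⟨l, rfl⟩ := red_surjective p e
      obtain ⟨h0, h1⟩ := mem_isoVecs.1 he
      obtain ⟨q, g, hq, hg⟩ := SubOrder.exists_left_factor (e := pureQuat l) Fact.out h2
        (by rwa [nrm_pureQuat, dvd_tVal_iff]) (by rwa [← red_eq_zero_iff])
      exact ⟨l, q, g, fun _ => ⟨rfl, hq, hg⟩⟩
    · exact ⟨0, 0, 0, fun h => absurd h he⟩
  choose l q g h using h
  exact ⟨l, q, g, h⟩

open Classical in
/-- The similitude attached to a quaternion of norm `p` maps representations of `n` injectively to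
representations of `p²n`. -/
lemma card_sandwich {q : SubOrder} (hq : q.nrm = p) (n : ℤ) :
    #{u ∈ reps (p ^ 2 * n) | ∃ w, pureQuat u = q * w * star q} = #(reps n) := by
  have hp0 : (p : ℤ) ≠ 0 := int_prime.ne_zero
  have hpure : ∀ w, (q * pureQuat w * star q).re = 0 := by
    intro w
    rw [SubOrder.re_sandwich]; simp [pureQuat]
  symm
  refine card_bij (fun w _ => ((q * pureQuat w * star q).imI, (q * pureQuat w * star q).imJ,
    (q * pureQuat w * star q).imK)) ?_ ?_ ?_
  · intro w hw
    rw [mem_filter, mem_reps, ← eq_pureQuat (hpure w), ← nrm_pureQuat, ← eq_pureQuat (hpure w),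
      SubOrder.nrm_sandwich hq, nrm_pureQuat, mem_reps.1 hw]
    exact ⟨rfl, _, rfl⟩
  · intro w _ w' _ h
    have h1 := congrArg pureQuat h
    rw [← eq_pureQuat (hpure w), ← eq_pureQuat (hpure w')] at h1
    exact pureQuat_injective (SubOrder.sandwich_cancel hp0 hq h1)
  · intro u hu
    rw [mem_filter, mem_reps] at hu
    obtain ⟨hu, w, hw⟩ := hu
    have hre : w.re = 0 := by
      have h1 := congrArg QuaternionAlgebra.re hw
      rw [SubOrder.re_sandwich, hq] at h1
      simpa [pureQuat, (Fact.out : p.Prime).ne_zero] using h1.symm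
    rw [eq_pureQuat hre] at hw
    refine ⟨(w.imI, w.imJ, w.imK), ?_, ?_⟩
    · rw [mem_reps, ← nrm_pureQuat]
      refine mul_left_cancel₀ (pow_ne_zero 2 hp0) ?_
      rw [← SubOrder.nrm_sandwich hq, ← hw, nrm_pureQuat, hu]
    · apply pureQuat_injective
      rw [← hw]; rfl

lemma divBy_mul_iff (h3 : p ≠ 3) {u e : ℤ × ℤ × ℤ}
    (hu : qf (red p u) = 0) (he : qf (red p e) = 0) :
    SubOrder.DivBy p (pureQuat u * pureQuat e) ↔ bf (red p u) (red p e) = 0 := by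
  rw [bf_red, ZMod.intCast_zmod_eq_zero_iff_dvd, dvd_neg, SubOrder.re_mul_comm]
  refine ⟨fun h => (SubOrder.divBy_iff.1 h).1, fun h => SubOrder.divBy_iff.2 ⟨h, ?_⟩⟩
  obtain ⟨a, b, c⟩ := cross_eq_zero h3 hu he
    (by rwa [bf_red, ZMod.intCast_zmod_eq_zero_iff_dvd, dvd_neg, SubOrder.re_mul_comm])
  simp only [← ZMod.intCast_zmod_eq_zero_iff_dvd]
  simp only [red] at a b c
  simp [pureQuat]
  refine ⟨?_, ?_, ?_⟩
  · linear_combination 3 * c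
  · linear_combination -b
  · linear_combination a

open Classical in
lemma filter_divBy_reps (n : ℤ) :
    {u ∈ reps (p ^ 2 * n) | SubOrder.DivBy p (pureQuat u)} =
      (reps n).image fun v => (p : ℤ) • v := by
  have hp0 : (p : ℤ) ≠ 0 := int_prime.ne_zero
  ext u
  simp only [mem_filter, mem_image, mem_reps, divBy_pureQuat_iff]
  constructor
  · rintro ⟨h, w, rfl⟩
    rw [tVal_smul] at h
    exact ⟨w, mul_left_cancel₀ (pow_ne_zero 2 hp0) h, rfl⟩
  · rintro ⟨w, rfl, rfl⟩
    exact ⟨tVal_smul _ _, w, rfl⟩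

open Classical in
lemma card_filter_divBy_reps (n : ℤ) :
    #{u ∈ reps (p ^ 2 * n) | SubOrder.DivBy p (pureQuat u)} = #(reps n) := by
  rw [filter_divBy_reps, card_image_of_injective _ (smul_right_injective _ int_prime.ne_zero)]

open Classical in
/-- The Hecke relation at `p` between the numbers of representations of `n` and of `p²n`. -/
lemma hecke (h2 : p ≠ 2) (h3 : p ≠ 3) (n : ℤ) :
    (p ^ 2 - 1) * (#(reps n) : ℤ) =
      (p - 1) * ((#(reps (p ^ 2 * n)) : ℤ) - #(reps n)) +
        ∑ v ∈ reps n, (orthCount (red p v) : ℤ) := by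
  have hp0 : (p : ℤ) ≠ 0 := int_prime.ne_zero
  obtain ⟨l, q, g, hl⟩ := exists_left_factors (p := p) h2
  have hre : ∀ v, (pureQuat v).re = 0 := fun v => rfl
  have hprim : ∀ u ∈ reps (p ^ 2 * n), ¬ SubOrder.DivBy p (pureQuat u) →
      #{e ∈ isoVecs p | ∃ w, pureQuat u = q e * w * star (q e)} = p - 1 := by
    intro u hu hnu
    have hN := mem_reps.1 hu
    have hu0 : qf (red p u) = 0 := by
      rw [← dvd_tVal_iff, hN]
      exact ((dvd_pow_self _ two_ne_zero).mul_right n)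
    rw [← orthCount_of_isotropic h3 (by rwa [Ne, red_eq_zero_iff]) hu0, orthCount]
    congr 1
    refine filter_congr fun e he => ?_
    obtain ⟨hle, hq, hg⟩ := hl e he
    obtain ⟨he0, he1⟩ := mem_isoVecs.1 he
    rw [SubOrder.exists_sandwich_iff int_prime (not_dvd_two h2) (not_dvd_three h3) hq hg (hre _)
      (by rwa [← red_eq_zero_iff, hle]) (hre _) hnu
      (by rw [nrm_pureQuat, hN]; exact dvd_mul_right _ _),
      divBy_mul_iff h3 hu0 (by rwa [hle]), hle]
  have hmul : ∀ v : ℤ × ℤ × ℤ,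
      #{e ∈ isoVecs p | ∃ w, pureQuat ((p : ℤ) • v) = q e * w * star (q e)} =
        orthCount (red p v) := by
    intro v
    rw [orthCount]
    congr 1
    refine filter_congr fun e he => ?_
    obtain ⟨hle, hq, hg⟩ := hl e he
    obtain ⟨he0, he1⟩ := mem_isoVecs.1 he
    rw [pureQuat_smul, SubOrder.exists_smul_sandwich_iff int_prime (not_dvd_two h2)
      (not_dvd_three h3) hq hg (hre _) (by rwa [← red_eq_zero_iff, hle])]
    rw [← congrArg (bf (red p v) · = 0) hle, bf_red, ZMod.intCast_zmod_eq_zero_iff_dvd, dvd_neg]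
  have hswap := sum_card_bipartiteAbove_eq_sum_card_bipartiteBelow
    (s := reps (p ^ 2 * n)) (t := isoVecs p)
    (fun u e => ∃ w, pureQuat u = q e * w * star (q e))
  simp only [bipartiteAbove, bipartiteBelow] at hswap
  rw [sum_congr rfl fun e he => card_sandwich (hl e he).2.1 n, sum_const, smul_eq_mul,
    ← sum_filter_add_sum_filter_not _ (fun u => SubOrder.DivBy p (pureQuat u)), filter_divBy_reps,
    sum_image (smul_right_injective _ hp0).injOn, sum_congr rfl fun v _ => hmul v,
    sum_congr rfl fun u hu => hprim u (mem_filter.1 hu).1 (mem_filter.1 hu).2, sum_const,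
    smul_eq_mul] at hswap
  have hsplit := card_filter_add_card_filter_not (s := reps (p ^ 2 * n))
    (fun u => SubOrder.DivBy p (pureQuat u))
  rw [card_filter_divBy_reps] at hsplit
  have h1 := card_isoVecs (p := p) h2
  have h4 : ((p - 1 : ℕ) : ℤ) = p - 1 := by
    rw [Nat.cast_sub (Fact.out : p.Prime).one_le, Nat.cast_one]
  zify at hswap hsplit
  rw [← h1, ← hswap, h4, ← hsplit]
  ring

lemma prime_sub_one_ne_zero : ((p : ℤ) - 1) ≠ 0 := by
  have := (Fact.out : p.Prime).one_lt
  lia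

lemma card_reps_of_not_dvd (h2 : p ≠ 2) (h3 : p ≠ 3) {m : ℤ} (hm : ¬ (p : ℤ) ∣ m) :
    (#(reps (p ^ 2 * m ^ 2)) : ℤ) =
      (p + 1 - quadraticChar (ZMod p) (-1)) * #(reps (m ^ 2)) := by
  have h := hecke h2 h3 (m ^ 2)
  rw [sum_congr rfl fun v hv => orthCount_of_sq h2 h3 (m := (m : ZMod p))
    (by rwa [Ne, ZMod.intCast_zmod_eq_zero_iff_dvd])
    (by rw [qf_red, mem_reps.1 hv, Int.cast_pow]), sum_const, nsmul_eq_mul] at h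
  refine mul_left_cancel₀ (prime_sub_one_ne_zero (p := p)) ?_
  linear_combination -h

open Classical in
lemma card_reps_sq_mul_sq_mul (h2 : p ≠ 2) (h3 : p ≠ 3) (n : ℤ) :
    (#(reps (p ^ 2 * (p ^ 2 * n))) : ℤ) =
      (p + 1) * #(reps (p ^ 2 * n)) - p * #(reps n) := by
  have h := hecke h2 h3 (p ^ 2 * n)
  have h4 : ((p - 1 : ℕ) : ℤ) = p - 1 := by
    rw [Nat.cast_sub (Fact.out : p.Prime).one_le, Nat.cast_one]
  have hsplit := card_filter_add_card_filter_not (s := reps (p ^ 2 * n))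
    (fun u => SubOrder.DivBy p (pureQuat u))
  rw [card_filter_divBy_reps] at hsplit
  zify at hsplit
  have hdiv : ∀ u ∈ (reps (p ^ 2 * n)).filter (fun u => SubOrder.DivBy p (pureQuat u)),
      (orthCount (red p u) : ℤ) = p ^ 2 - 1 := fun u hu => by
    rw [(red_eq_zero_iff p u).2 (mem_filter.1 hu).2, orthCount_zero h2]
  have hnot : ∀ u ∈ (reps (p ^ 2 * n)).filter (fun u => ¬ SubOrder.DivBy p (pureQuat u)),
      (orthCount (red p u) : ℤ) = p - 1 := fun u hu => by
    rw [mem_filter, ← red_eq_zero_iff] at hu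
    rw [orthCount_of_isotropic h3 hu.2, h4]
    rw [← dvd_tVal_iff, mem_reps.1 hu.1]
    exact (dvd_pow_self _ two_ne_zero).mul_right n
  rw [← sum_filter_add_sum_filter_not _ (fun u => SubOrder.DivBy p (pureQuat u)),
    sum_congr rfl hdiv, sum_congr rfl hnot, sum_const, sum_const, card_filter_divBy_reps,
    nsmul_eq_mul, nsmul_eq_mul] at h
  refine mul_left_cancel₀ (prime_sub_one_ne_zero (p := p)) ?_
  linear_combination -h - (p - 1) * hsplit

lemma tHp_eq_sum (h3 : p ≠ 3) (k : ℕ) :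
    tHp 1 3 3 p k = ∑ i ∈ range (k + 1), (p : ℤ) ^ i -
      quadraticChar (ZMod p) (-1) * ∑ i ∈ range k, (p : ℤ) ^ i := by
  have hgeom : ∀ k : ℕ, ((p : ℤ) ^ k - 1) / (p - 1) = ∑ i ∈ range k, (p : ℤ) ^ i := fun k => by
    rw [← mul_geom_sum, Int.mul_ediv_cancel_left _ prime_sub_one_ne_zero]
  have hchar : jacobiSym (-(1 * 3 * 3)) p = quadraticChar (ZMod p) (-1) := by
    rw [← jacobiSym.legendreSym.to_jacobiSym, legendreSym]
    have : ((-(1 * 3 * 3) : ℤ) : ZMod p) = -1 * 3 ^ 2 := by push_cast; ring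
    rw [this, map_mul, quadraticChar_sq_one' (three_ne_zero_zmod h3), mul_one]
  rw [tHp, hgeom, hgeom, hchar]

/-- The numbers of representations of `p^(2k) m²` for `p` not dividing `m`. -/
lemma card_reps_prime_pow (h2 : p ≠ 2) (h3 : p ≠ 3) {m : ℤ} (hm : ¬ (p : ℤ) ∣ m) (k : ℕ) :
    (#(reps ((p ^ k * m) ^ 2)) : ℤ) = #(reps (m ^ 2)) * tHp 1 3 3 p k := by
  induction k using Nat.twoStepInduction with
  | zero => simp [tHp_eq_sum h3]
  | one =>
    rw [pow_one, mul_pow, card_reps_of_not_dvd h2 h3 hm, tHp_eq_sum h3]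
    simp [sum_range_succ]
    ring
  | more k ih1 ih2 =>
    have e1 : ((p : ℤ) ^ (k + 2) * m) ^ 2 = p ^ 2 * (p ^ 2 * (p ^ k * m) ^ 2) := by ring
    have e2 : ((p : ℤ) ^ (k + 1) * m) ^ 2 = p ^ 2 * (p ^ k * m) ^ 2 := by ring
    rw [e1, card_reps_sq_mul_sq_mul h2 h3, ← e2, ih1, ih2]
    simp only [tHp_eq_sum h3, sum_range_succ]
    ring

end Prime

end TernaryForm

/-- The ternary form `x² + 3y² + 3z²`-type form `⟨1,3,3⟩` is strongly s-regular. -/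
theorem stmt_18 (n₁ n₂ : ℕ) (h₁ : 0 < n₁) (h₂ : 0 < n₂)
    (hfac : ∀ p : ℕ, p.Prime → p ∣ n₁ → p = 2 ∨ p = 3) (hcop : Nat.Coprime n₂ 6) :
    (tRep 1 3 3 (((n₁ : ℤ) * (n₂ : ℤ)) ^ 2) : ℤ) =
      (tRep 1 3 3 ((n₁ : ℤ) ^ 2) : ℤ) *
        ∏ p ∈ n₂.primeFactors, tHp 1 3 3 p (n₂.factorization p) := by
  simp only [TernaryForm.tRep_eq_card_reps]
  induction n₂ using Nat.recOnPrimePow with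
  | zero => exact absurd h₂ (lt_irrefl 0)
  | one => simp
  | prime_pow_mul a p k hp hpa hk ih =>
    have ha : a ≠ 0 := by rintro rfl; simp at hpa
    have : Fact p.Prime := ⟨hp⟩
    have hcop' : Nat.Coprime p 6 :=
      hcop.coprime_dvd_left ((dvd_pow_self p hk.ne').mul_right a)
    have h2 : p ≠ 2 := by rintro rfl; revert hcop'; decide
    have h3 : p ≠ 3 := by rintro rfl; revert hcop'; decide
    have hm : ¬ (p : ℤ) ∣ n₁ * a := by
      intro h
      rcases hp.dvd_mul.1 (by exact_mod_cast h : p ∣ n₁ * a) with h | h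
      · exact (hfac p hp h).elim h2 h3
      · exact hpa h
    have hprod : ∏ r ∈ (p ^ k * a).primeFactors, tHp 1 3 3 r ((p ^ k * a).factorization r) =
        tHp 1 3 3 p k * ∏ r ∈ a.primeFactors, tHp 1 3 3 r (a.factorization r) := by
      have hpf : (p ^ k * a).primeFactors = insert p a.primeFactors := by
        rw [Nat.primeFactors_mul (pow_ne_zero k hp.ne_zero) ha, Nat.primeFactors_pow p hk.ne',
          hp.primeFactors, insert_eq]
      have hfac' : (p ^ k * a).factorization = k • p.factorization + a.factorization := by
        rw [Nat.factorization_mul (pow_ne_zero k hp.ne_zero) ha, Nat.factorization_pow]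
      rw [hpf, prod_insert (fun h => hpa (Nat.dvd_of_mem_primeFactors h)), hfac']
      congr 1
      · simp [hp.factorization_self, Nat.factorization_eq_zero_of_not_dvd hpa]
      · refine prod_congr rfl fun r hr => ?_
        have hrp : ¬ r ∣ p := fun h => hpa <|
          (Nat.prime_dvd_prime_iff_eq (Nat.prime_of_mem_primeFactors hr) hp).1 h ▸
            Nat.dvd_of_mem_primeFactors hr
        simp [Nat.factorization_eq_zero_of_not_dvd hrp]
    have hval : (n₁ : ℤ) * ((p ^ k * a : ℕ) : ℤ) = p ^ k * (n₁ * a) := by push_cast; ring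
    rw [hval, TernaryForm.card_reps_prime_pow h2 h3 hm,
      ih (Nat.pos_of_ne_zero ha) (hcop.coprime_dvd_left (dvd_mul_left _ _)), hprod]
    ring
end

section
/- For every integer t ≥ 0, the binary quadratic form L_t(x,y) = 2x² + 3^{2t} y² is strongly s-regular: for every positive integer n = n₁n₂ with every prime factor of n₁ in {2, 3} and gcd(n₂, 6) = 1, r(n₁²n₂², L_t) = r(n₁², L_t) · ∏_{p | n₂} h_p(dL_t, ord_p(n₂)). -/
open Finset

/-- The value of the binary quadratic form `a x² + b x y + c y²`. -/
def bVal (a b c x y : ℤ) : ℤ := a * x ^ 2 + b * x * y + c * y ^ 2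

/-- Positive definiteness of a binary quadratic form. -/
def bPosDef (a b c : ℤ) : Prop := ∀ x y : ℤ, ¬(x = 0 ∧ y = 0) → 0 < bVal a b c x y

/-- The number of representations of `n` by the binary form `a x² + b x y + c y²`. -/
noncomputable def bRep (a b c : ℤ) (n : ℤ) : ℕ :=
  Set.ncard {v : ℤ × ℤ | bVal a b c v.1 v.2 = n}

/-- The discriminant `4ac - b²` of a binary quadratic form. -/
def bDisc (a b c : ℤ) : ℤ := 4 * a * c - b ^ 2

/-- The local factor `h_p(d, μ) = ∑_{t=0}^{2μ} χ(p)^t` with `χ(p) = (-d | p)` for binary forms. -/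
def bHp (d : ℤ) (p : ℕ) (μ : ℕ) : ℤ :=
  ∑ t ∈ Finset.range (2 * μ + 1), (jacobiSym (-d) p) ^ t

/-- Almost strong s-regularity of a binary form with respect to a finite set `P` of primes. -/
def bASSR (a b c : ℤ) (P : Finset ℕ) : Prop :=
  ∀ n₁ n₂ : ℕ, 0 < n₁ → 0 < n₂ →
    (∀ p : ℕ, p.Prime → p ∣ n₁ → p ∈ P ∨ (p : ℤ) ∣ 2 * bDisc a b c) →
    IsCoprime (n₂ : ℤ) (2 * bDisc a b c) → (∀ p ∈ P, ¬ p ∣ n₂) →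
    (bRep a b c (((n₁ : ℤ) * (n₂ : ℤ)) ^ 2) : ℤ) =
      (bRep a b c ((n₁ : ℤ) ^ 2) : ℤ) *
        ∏ p ∈ n₂.primeFactors, bHp (bDisc a b c) p (n₂.factorization p)

/-- The minimum of positive integers `n` such that `n²` is represented by the binary form. -/
noncomputable def bMs (a b c : ℤ) : ℕ :=
  sInf {n : ℕ | 0 < n ∧ bRep a b c ((n : ℤ) ^ 2) ≠ 0}

/-- The set of elements of `ℤ[√-2]` of norm `N`. -/
def normFiber (N : ℤ) : Set (ℤ√(-2)) := {α | α.norm = N}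

theorem mem_normFiber {N : ℤ} {α : ℤ√(-2)} :
    α ∈ normFiber N ↔ α.re ^ 2 + 2 * α.im ^ 2 = N := by
  simp only [normFiber, Set.mem_ofPred_eq, Zsqrtd.norm_def]
  constructor <;> intro h <;> linarith

theorem finite_normFiber (N : ℤ) : (normFiber N).Finite := by
  have hinj : Function.Injective (fun α : ℤ√(-2) => (α.re, α.im)) := by
    intro α β h
    simp only [Prod.mk.injEq] at h
    exact Zsqrtd.ext h.1 h.2
  refine Set.Finite.of_finite_image (f := fun α : ℤ√(-2) => (α.re, α.im)) ?_ hinj.injOn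
  refine ((Set.finite_Icc (-N) N).prod (Set.finite_Icc (-N) N)).subset ?_
  rintro _ ⟨α, hα, rfl⟩
  rw [mem_normFiber] at hα
  have h1 := Int.natAbs_le_self_sq α.re
  have h2 := Int.natAbs_le_self_sq α.im
  rw [Int.natCast_natAbs] at h1 h2
  simp only [Set.mem_prod, Set.mem_Icc, ← abs_le]
  constructor <;> nlinarith [sq_nonneg α.re, sq_nonneg α.im]

theorem bRep_eq_ncard_normFiber (N : ℤ) : bRep 2 0 1 N = (normFiber N).ncard := by
  unfold bRep
  refine Set.ncard_congr (fun v _ => (⟨v.2, v.1⟩ : ℤ√(-2))) ?_ ?_ ?_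
  · rintro ⟨x, y⟩ h
    simp only [Set.mem_ofPred_eq, bVal] at h
    rw [mem_normFiber]
    simp only
    linarith
  · rintro ⟨x, y⟩ ⟨x', y'⟩ _ _ h
    simp only [Zsqrtd.ext_iff] at h
    simp [h.1, h.2]
  · intro α hα
    rw [mem_normFiber] at hα
    refine ⟨(α.im, α.re), ?_, rfl⟩
    simp only [Set.mem_ofPred_eq, bVal]
    linarith

/-- Descent: if some multiple `k * p` of a prime `p` with `0 < k < p` is of the form `x² + 2y²`,
then so is `p`. -/
theorem exists_sq_add_two_mul_sq_of_mul {p : ℕ} (hp : p.Prime) (k : ℕ) (hk : 0 < k) (hkp : k < p)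
    (x y : ℤ) (h : (k : ℤ) * p = x ^ 2 + 2 * y ^ 2) : ∃ u v : ℤ, (p : ℤ) = u ^ 2 + 2 * v ^ 2 := by
  induction k using Nat.strong_induction_on generalizing x y with
  | _ k ih =>
  rcases Nat.eq_or_lt_of_le hk with h1 | h1
  · exact ⟨x, y, by rw [← h, ← h1]; simp⟩
  have hkZ : (0 : ℤ) < k := by exact_mod_cast hk
  have hbound : ∀ z : ℤ, ∃ z' s : ℤ, z = z' + k * s ∧ 4 * z' ^ 2 ≤ (k : ℤ) ^ 2 := by
    intro z
    refine ⟨z.bmod k, z.bdiv k, (Int.bmod_add_bdiv z k).symm, ?_⟩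
    have h2 := Int.le_bmod (x := z) hk
    have h3 := Int.bmod_le (x := z) hk
    have h4 : -(k : ℤ) ≤ 2 * z.bmod k := by omega
    have h5 : 2 * z.bmod k ≤ k := by omega
    nlinarith
  obtain ⟨a, s, rfl, ha⟩ := hbound x
  obtain ⟨b, r, rfl, hb⟩ := hbound y
  have hdvd : (k : ℤ) ∣ a ^ 2 + 2 * b ^ 2 :=
    ⟨p - 2 * a * s - k * s ^ 2 - 4 * b * r - 2 * k * r ^ 2, by linear_combination -h⟩
  obtain ⟨k', hk'⟩ := hdvd
  have hk'0 : 0 ≤ k' := by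
    by_contra! hneg
    nlinarith [sq_nonneg a, sq_nonneg b]
  have hk'lt : k' < k := by
    by_contra! hge
    nlinarith
  lift k' to ℕ using hk'0
  have hk'pos : 0 < k' := by
    rcases Nat.eq_zero_or_pos k' with h0 | h0
    · exfalso
      subst h0
      have ha0 : a = 0 := by
        have : a ^ 2 = 0 := by
          push_cast at hk'
          nlinarith [sq_nonneg a, sq_nonneg b]
        simpa using this
      have hb0 : b = 0 := by
        have : b ^ 2 = 0 := by
          push_cast at hk'
          nlinarith [sq_nonneg a, sq_nonneg b]
        simpa using this
      subst ha0 hb0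
      have : (k : ℤ) ∣ p := by
        refine ⟨s ^ 2 + 2 * r ^ 2, ?_⟩
        apply mul_left_cancel₀ hkZ.ne'
        linear_combination h
      have := (Nat.dvd_prime hp).1 (by exact_mod_cast this)
      omega
    · exact h0
  refine ih k' (by exact_mod_cast hk'lt) hk'pos (by omega) (k' + s * a + 2 * r * b)
    (r * a - s * b) ?_
  apply mul_left_cancel₀ (pow_ne_zero 2 hkZ.ne')
  linear_combination (a ^ 2 + 2 * b ^ 2) * h + (a ^ 2 + 2 * b ^ 2 + k * k' - k * p
    + 2 * k * (s * a + 2 * r * b)) * hk'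

/-- A prime modulo which `-2` is a square is of the form `u² + 2v²`. -/
theorem exists_sq_add_two_mul_sq {p : ℕ} (hp : p.Prime) {a : ℤ} (h : (p : ℤ) ∣ a ^ 2 + 2) :
    ∃ u v : ℤ, (p : ℤ) = u ^ 2 + 2 * v ^ 2 := by
  rcases Nat.lt_or_ge p 4 with h4 | h4
  · have := hp.two_le
    interval_cases p
    · exact ⟨0, 1, by norm_num⟩
    · exact ⟨1, 1, by norm_num⟩
  have hdvd : (p : ℤ) ∣ (a.bmod p) ^ 2 + 2 := by
    have := Int.bmod_add_bdiv a p
    obtain ⟨c, hc⟩ := h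
    refine ⟨c - 2 * a.bmod p * a.bdiv p - p * (a.bdiv p) ^ 2, ?_⟩
    linear_combination hc - (a + a.bmod p + p * a.bdiv p) * this.symm
  obtain ⟨k, hk⟩ := hdvd
  have h2 := Int.le_bmod (x := a) hp.pos
  have h3 := Int.bmod_le (x := a) hp.pos
  have h4 : -(p : ℤ) ≤ 2 * a.bmod p := by omega
  have h5 : 2 * a.bmod p ≤ p := by omega
  have hpZ : (4 : ℤ) ≤ p := by exact_mod_cast ‹4 ≤ p›
  have hk0 : 0 < k := by
    by_contra! hneg
    nlinarith [sq_nonneg (a.bmod p)]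
  have hklt : k < p := by
    by_contra! hge
    nlinarith
  lift k to ℕ using hk0.le
  exact exists_sq_add_two_mul_sq_of_mul hp k (by exact_mod_cast hk0) (by exact_mod_cast hklt)
    (a.bmod p) 1 (by linear_combination -hk)

theorem dvd_or_star_dvd_of_dvd_norm {p : ℕ} (hp : p.Prime) {π α : ℤ√(-2)} (hπ : π.norm = p)
    (hα : (p : ℤ) ∣ α.norm) : π ∣ α ∨ star π ∣ α := by
  have key : ∀ ρ : ℤ√(-2), ρ.norm = p → (p : ℤ) ∣ α.im * ρ.re - α.re * ρ.im → ρ ∣ α := by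
    intro ρ hρ hd
    have hpp : Prime (p : ℤ) := Nat.prime_iff_prime_int.1 hp
    have hd2 : (p : ℤ) ∣ α.re * ρ.re + 2 * α.im * ρ.im := by
      apply hpp.dvd_of_dvd_pow (n := 2)
      have : (α.re * ρ.re + 2 * α.im * ρ.im) ^ 2
          = α.norm * ρ.norm - 2 * (α.im * ρ.re - α.re * ρ.im) ^ 2 := by
        simp only [Zsqrtd.norm_def]; ring
      rw [this]
      exact dvd_sub (hα.mul_right _) ((dvd_pow hd two_ne_zero).mul_left _)
    obtain ⟨c, hc⟩ := hd
    obtain ⟨d, hd⟩ := hd2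
    have hp0 : (p : ℤ) ≠ 0 := hpp.ne_zero
    rw [Zsqrtd.norm_def] at hρ
    refine ⟨⟨d, c⟩, ?_⟩
    ext
    · apply mul_left_cancel₀ hp0
      simp only [Zsqrtd.re_mul]
      linear_combination ρ.re * hd - 2 * ρ.im * hc - α.re * hρ
    · apply mul_left_cancel₀ hp0
      simp only [Zsqrtd.im_mul]
      linear_combination ρ.re * hc + ρ.im * hd - α.im * hρ
  have hprod : (p : ℤ) ∣ (α.im * π.re - α.re * π.im) * (α.im * π.re + α.re * π.im) := by
    have : (α.im * π.re - α.re * π.im) * (α.im * π.re + α.re * π.im)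
        = α.im ^ 2 * π.norm - π.im ^ 2 * α.norm := by
      simp only [Zsqrtd.norm_def]; ring
    rw [this, hπ]
    exact dvd_sub (dvd_mul_left _ _) (hα.mul_left _)
  rcases (Nat.prime_iff_prime_int.1 hp).dvd_or_dvd hprod with h | h
  · exact Or.inl (key π hπ h)
  · refine Or.inr (key (star π) (by rw [Zsqrtd.norm_conj, hπ]) ?_)
    simpa [sub_neg_eq_add] using h

theorem natCast_dvd_of_dvd_of_star_dvd {p : ℕ} (hp : p.Prime) (hp2 : p ≠ 2) {π α : ℤ√(-2)}
    (hπ : π.norm = p) (h : π ∣ α) (h' : star π ∣ α) : (p : ℤ√(-2)) ∣ α := by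
  have hpp : Prime (p : ℤ) := Nat.prime_iff_prime_int.1 hp
  have hp2' : ¬ (p : ℤ) ∣ 2 := fun h => hp2 ((Nat.prime_dvd_prime_iff_eq hp Nat.prime_two).1
    (by exact_mod_cast h))
  have hre : ¬ (p : ℤ) ∣ π.re := by
    intro hr
    rw [Zsqrtd.norm_def] at hπ
    have him : (p : ℤ) ∣ π.im := by
      have : (p : ℤ) ∣ 2 * π.im ^ 2 := by
        have : 2 * π.im ^ 2 = p - π.re * π.re := by linear_combination hπ
        rw [this]
        exact dvd_sub dvd_rfl (hr.mul_right _)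
      exact hpp.dvd_of_dvd_pow ((hpp.dvd_or_dvd this).resolve_left hp2')
    obtain ⟨a, ha⟩ := hr
    obtain ⟨b, hb⟩ := him
    have : (p : ℤ) * (a ^ 2 + 2 * b ^ 2) = 1 := by
      apply mul_left_cancel₀ hpp.ne_zero
      rw [ha, hb] at hπ
      linear_combination hπ
    exact hpp.not_isUnit (IsUnit.of_mul_eq_one _ this)
  obtain ⟨β, rfl⟩ := h
  obtain ⟨γ, hγ⟩ := h'
  rw [Zsqrtd.ext_iff] at hγ
  simp only [Zsqrtd.re_mul, Zsqrtd.im_mul, Zsqrtd.re_star, Zsqrtd.im_star] at hγ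
  rw [Zsqrtd.norm_def] at hπ
  have hd : (p : ℤ) ∣ π.re * β.im + π.im * β.re := by
    have : (p : ℤ) ∣ 2 * (π.re * (π.re * β.im + π.im * β.re)) :=
      ⟨β.im + γ.im, by linear_combination (β.im + γ.im) * hπ + π.re * hγ.2 + π.im * hγ.1⟩
    exact (hpp.dvd_or_dvd ((hpp.dvd_or_dvd this).resolve_left hp2')).resolve_left hre
  have hd' : (p : ℤ) ∣ π.re * β.re + -2 * π.im * β.im := by
    apply hpp.dvd_of_dvd_pow (n := 2)
    have : (π.re * β.re + -2 * π.im * β.im) ^ 2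
        = p * β.norm - 2 * (π.re * β.im + π.im * β.re) ^ 2 := by
      rw [← hπ, Zsqrtd.norm_def]
      ring
    rw [this]
    exact dvd_sub (dvd_mul_right _ _) ((dvd_pow hd two_ne_zero).mul_left _)
  have := (Zsqrtd.intCast_dvd (d := -2) (p : ℤ) (π * β)).2
    ⟨by simpa only [Zsqrtd.re_mul] using hd', by simpa only [Zsqrtd.im_mul] using hd⟩
  simpa using this

theorem image_mul_left_normFiber {q : ℤ} (hq : q ≠ 0) {ρ : ℤ√(-2)} (hρ : ρ.norm = q) (N : ℤ) :
    (ρ * ·) '' normFiber N = {α ∈ normFiber (q * N) | ρ ∣ α} := by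
  ext α
  simp only [Set.mem_image, normFiber, Set.mem_ofPred_eq]
  constructor
  · rintro ⟨β, rfl, rfl⟩
    exact ⟨by rw [Zsqrtd.norm_mul, hρ], dvd_mul_right _ _⟩
  · rintro ⟨h, β, rfl⟩
    rw [Zsqrtd.norm_mul, hρ] at h
    exact ⟨β, mul_left_cancel₀ hq h, rfl⟩

theorem injective_mul_left_of_norm_ne_zero {ρ : ℤ√(-2)} (hρ : ρ.norm ≠ 0) :
    Function.Injective (ρ * ·) := by
  intro α β h
  have h' : star ρ * (ρ * α) = star ρ * (ρ * β) := congrArg (star ρ * ·) h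
  rw [← mul_assoc, ← mul_assoc, mul_comm (star ρ), ← Zsqrtd.norm_eq_mul_conj] at h'
  rw [Zsqrtd.ext_iff] at h' ⊢
  simp only [Zsqrtd.re_mul, Zsqrtd.im_mul, Zsqrtd.re_intCast, Zsqrtd.im_intCast, mul_zero,
    zero_mul, add_zero] at h'
  exact ⟨mul_left_cancel₀ hρ h'.1, mul_left_cancel₀ hρ h'.2⟩

theorem ncard_dvd_normFiber {q : ℤ} (hq : q ≠ 0) {ρ : ℤ√(-2)} (hρ : ρ.norm = q) (N : ℤ) :
    {α ∈ normFiber (q * N) | ρ ∣ α}.ncard = (normFiber N).ncard := by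
  rw [← image_mul_left_normFiber hq hρ]
  exact Set.ncard_image_of_injective _ (injective_mul_left_of_norm_ne_zero (hρ ▸ hq))

theorem ncard_normFiber_mul_of_norm_eq {p : ℕ} (hp : p.Prime) (hp2 : p ≠ 2) {π : ℤ√(-2)}
    (hπ : π.norm = p) (N : ℤ) :
    (normFiber (p * N)).ncard + {α ∈ normFiber (p * N) | (p : ℤ√(-2)) ∣ α}.ncard =
      2 * (normFiber N).ncard := by
  have hp0 : (p : ℤ) ≠ 0 := by exact_mod_cast hp.ne_zero
  have hπ' : (star π).norm = p := by rw [Zsqrtd.norm_conj, hπ]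
  have hpp : (p : ℤ√(-2)) = π * star π := by
    rw [← Zsqrtd.norm_eq_mul_conj, hπ]
    simp
  have hunion : normFiber (p * N) =
      {α ∈ normFiber (p * N) | π ∣ α} ∪ {α ∈ normFiber (p * N) | star π ∣ α} := by
    ext α
    simp only [Set.mem_union, Set.mem_ofPred_eq, ← and_or_left]
    refine ⟨fun h => ⟨h, dvd_or_star_dvd_of_dvd_norm hp hπ ?_⟩, fun h => h.1⟩
    exact ⟨N, h⟩
  have hinter : {α ∈ normFiber (p * N) | (p : ℤ√(-2)) ∣ α} =
      {α ∈ normFiber (p * N) | π ∣ α} ∩ {α ∈ normFiber (p * N) | star π ∣ α} := by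
    ext α
    simp only [Set.mem_inter_iff, Set.mem_ofPred_eq]
    refine ⟨fun h => ⟨⟨h.1, ?_⟩, h.1, ?_⟩,
      fun h => ⟨h.1.1, natCast_dvd_of_dvd_of_star_dvd hp hp2 hπ h.1.2 h.2.2⟩⟩
    · exact (Dvd.intro _ hpp.symm).trans h.2
    · exact (Dvd.intro_left _ hpp.symm).trans h.2
  have hfin := finite_normFiber (p * N)
  rw [hinter]
  have := Set.ncard_union_add_ncard_inter {α ∈ normFiber (p * N) | π ∣ α}
    {α ∈ normFiber (p * N) | star π ∣ α} (hfin.subset (Set.sep_subset _ _))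
    (hfin.subset (Set.sep_subset _ _))
  rw [← hunion, ncard_dvd_normFiber hp0 hπ, ncard_dvd_normFiber hp0 hπ'] at this
  rw [this, two_mul]

theorem ncard_normFiber_pow_mul_of_norm_eq {p : ℕ} (hp : p.Prime) (hp2 : p ≠ 2) {π : ℤ√(-2)}
    (hπ : π.norm = p) {N : ℤ} (hN : ¬ (p : ℤ) ∣ N) (k : ℕ) :
    (normFiber (p ^ k * N)).ncard = (k + 1) * (normFiber N).ncard := by
  have hp0 : (p : ℤ) ≠ 0 := by exact_mod_cast hp.ne_zero
  have hnorm : (p : ℤ√(-2)).norm = p * p := Zsqrtd.norm_natCast p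
  induction k using Nat.twoStepInduction with
  | zero => simp
  | one =>
    have h := ncard_normFiber_mul_of_norm_eq hp hp2 hπ N
    have hempty : {α ∈ normFiber (p * N) | (p : ℤ√(-2)) ∣ α} = ∅ := by
      rw [Set.eq_empty_iff_forall_notMem]
      rintro _ ⟨hα, β, rfl⟩
      simp only [normFiber, Set.mem_ofPred_eq, Zsqrtd.norm_mul, hnorm, mul_assoc] at hα
      exact hN ⟨_, (mul_left_cancel₀ hp0 hα).symm⟩
    rw [hempty, Set.ncard_empty, add_zero] at h
    rw [pow_one, h]
  | more k ih₀ ih₁ =>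
    have h := ncard_normFiber_mul_of_norm_eq hp hp2 hπ (p ^ (k + 1) * N)
    have hpow : (p : ℤ) * (p ^ (k + 1) * N) = p * p * (p ^ k * N) := by ring
    have hpow' : (p : ℤ) ^ (k + 2) * N = p * p * (p ^ k * N) := by ring
    rw [hpow, ncard_dvd_normFiber (mul_ne_zero hp0 hp0) hnorm, ih₀, ih₁] at h
    rw [hpow']
    linarith

theorem ncard_normFiber_sq_mul_of_jacobiSym_eq_neg_one {p : ℕ} (hp : p.Prime)
    (h : jacobiSym (-2) p = -1) (N : ℤ) :
    (normFiber (p * p * N)).ncard = (normFiber N).ncard := by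
  have := Fact.mk hp
  have hp0 : (p : ℤ) ≠ 0 := by exact_mod_cast hp.ne_zero
  rw [← ncard_dvd_normFiber (mul_ne_zero hp0 hp0) (Zsqrtd.norm_natCast (d := -2) p) N]
  congr 1
  ext α
  refine ⟨fun hα => ⟨hα, ?_⟩, fun hα => hα.1⟩
  rw [mem_normFiber] at hα
  have hdvd : (p : ℤ) ∣ α.re ^ 2 - -2 * α.im ^ 2 := ⟨p * N, by linear_combination hα⟩
  have := (Zsqrtd.intCast_dvd (d := -2) (p : ℤ) α).2 (jacobiSym.prime_dvd_of_eq_neg_one h hdvd)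
  simpa using this

theorem exists_norm_eq_of_jacobiSym_eq_one {p : ℕ} (hp : p.Prime) (h : jacobiSym (-2) p = 1) :
    ∃ π : ℤ√(-2), π.norm = p := by
  have := Fact.mk hp
  have hne : ((-2 : ℤ) : ZMod p) ≠ 0 := by
    intro h0
    rw [← jacobiSym.legendreSym.to_jacobiSym, (legendreSym.eq_zero_iff p (-2)).2 h0] at h
    exact zero_ne_one h
  rw [← jacobiSym.legendreSym.to_jacobiSym, legendreSym.eq_one_iff p hne] at h
  obtain ⟨z, hz⟩ := h
  obtain ⟨a, rfl⟩ := ZMod.intCast_surjective z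
  have hdvd : (p : ℤ) ∣ a ^ 2 + 2 := by
    rw [← ZMod.intCast_zmod_eq_zero_iff_dvd]
    push_cast at hz ⊢
    linear_combination -hz
  obtain ⟨u, v, huv⟩ := exists_sq_add_two_mul_sq hp hdvd
  exact ⟨⟨u, v⟩, by rw [huv, Zsqrtd.norm_def]; ring⟩

theorem ncard_normFiber_prime_pow_mul_sq {p : ℕ} (hp : p.Prime) (hp2 : p ≠ 2) {m : ℕ}
    (hm : ¬ p ∣ m) (k : ℕ) :
    ((normFiber (((p ^ k * m : ℕ) : ℤ) ^ 2)).ncard : ℤ) =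
      (normFiber ((m : ℤ) ^ 2)).ncard * ∑ s ∈ range (2 * k + 1), jacobiSym (-2) p ^ s := by
  have hpow : ((p ^ k * m : ℕ) : ℤ) ^ 2 = p ^ (2 * k) * (m : ℤ) ^ 2 := by
    push_cast
    ring
  have hcop : Int.gcd (-2) p = 1 := by
    have : Nat.Coprime 2 p := (Nat.coprime_primes Nat.prime_two hp).2 hp2.symm
    simpa [Int.gcd] using this
  rw [hpow]
  rcases jacobiSym.eq_one_or_neg_one hcop with h | h
  · obtain ⟨π, hπ⟩ := exists_norm_eq_of_jacobiSym_eq_one hp h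
    have hm' : ¬ (p : ℤ) ∣ (m : ℤ) ^ 2 := fun hd =>
      hm (hp.dvd_of_dvd_pow (n := 2) (by exact_mod_cast hd))
    rw [ncard_normFiber_pow_mul_of_norm_eq hp hp2 hπ hm', h]
    simp [mul_comm]
  · have hsum : ∑ s ∈ range (2 * k + 1), jacobiSym (-2) p ^ s = 1 := by
      rw [h, neg_one_geom_sum, if_neg (by simp)]
    have hk : (normFiber (p ^ (2 * k) * (m : ℤ) ^ 2)).ncard = (normFiber ((m : ℤ) ^ 2)).ncard := by
      clear hsum hpow
      induction k with
      | zero => simp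
      | succ k ih =>
        rw [← ih, ← ncard_normFiber_sq_mul_of_jacobiSym_eq_neg_one hp h (p ^ (2 * k) * _)]
        congr 2
        ring
    rw [hsum, hk, mul_one]

theorem ncard_normFiber_mul_sq {m n : ℕ} (hn : n ≠ 0) (hn2 : ¬ 2 ∣ n) (hmn : Nat.Coprime m n) :
    ((normFiber (((m : ℤ) * n) ^ 2)).ncard : ℤ) = (normFiber ((m : ℤ) ^ 2)).ncard *
      ∏ p ∈ n.primeFactors, ∑ s ∈ range (2 * n.factorization p + 1), jacobiSym (-2) p ^ s := by
  induction n using Nat.recOnPrimePow with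
  | zero => exact absurd rfl hn
  | one => simp
  | prime_pow_mul a p k hp hpa hk ih =>
    have ha : a ≠ 0 := by rintro rfl; simp at hn
    have hpm : ¬ p ∣ m := fun h =>
      hp.one_lt.ne' (Nat.dvd_one.1 (hmn ▸ Nat.dvd_gcd h ((dvd_pow_self p hk.ne').mul_right a)))
    have hp2 : p ≠ 2 := by
      rintro rfl
      exact hn2 ((dvd_pow_self 2 hk.ne').mul_right a)
    have hcop : Nat.Coprime (p ^ k) a := ((Nat.Prime.coprime_iff_not_dvd hp).2 hpa).pow_left k
    have hprod : ∀ f : ℕ → ℕ → ℤ, ∏ q ∈ (p ^ k * a).primeFactors, f q ((p ^ k * a).factorization q)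
        = f p k * ∏ q ∈ a.primeFactors, f q (a.factorization q) := by
      intro f
      rw [hcop.primeFactors_mul, prod_union hcop.disjoint_primeFactors,
        Nat.primeFactors_prime_pow hk.ne' hp, prod_singleton]
      congr 1
      · rw [Nat.factorization_mul_apply_of_coprime hcop]
        simp [hp.factorization_self, Nat.factorization_eq_zero_of_not_dvd hpa]
      · refine prod_congr rfl fun q hq => ?_
        have hqp : p ≠ q := by
          rintro rfl
          exact hpa (Nat.dvd_of_mem_primeFactors hq)
        rw [Nat.factorization_mul_apply_of_coprime hcop, hp.factorization_pow]
        simp [hqp]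
    rw [hprod fun q e => ∑ s ∈ range (2 * e + 1), jacobiSym (-2) q ^ s]
    have hstep := ncard_normFiber_prime_pow_mul_sq hp hp2 (m := m * a)
      (fun h => (hp.dvd_mul.1 h).elim hpm hpa) k
    have hih := ih ha (fun h => hn2 (h.mul_left _)) (Nat.Coprime.coprime_mul_left_right hmn)
    have hcast : ((m : ℤ) * (p ^ k * a : ℕ)) = (p ^ k * (m * a) : ℕ) := by
      push_cast
      ring
    rw [hcast, hstep, Nat.cast_mul, hih]
    ring

theorem three_dvd_of_two_mul_sq_add {x n c : ℤ} (h : 2 * x ^ 2 + 3 * c = n ^ 2) :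
    (3 : ℤ) ∣ x ∧ (3 : ℤ) ∣ n := by
  have key : n ^ 2 % 3 = 2 * x ^ 2 % 3 := by omega
  have hx : x % 3 = 0 ∨ x % 3 = 1 ∨ x % 3 = 2 := by omega
  have hn : n % 3 = 0 ∨ n % 3 = 1 ∨ n % 3 = 2 := by omega
  rcases hx with hx | hx | hx <;> rcases hn with hn | hn | hn <;>
    (simp [pow_two, Int.mul_emod, hx, hn] at key; try omega)

theorem bRep_sq_eq_zero_of_not_three_dvd (t : ℕ) {n : ℤ} (hn : ¬ (3 : ℤ) ∣ n) :
    bRep 2 0 (3 ^ (2 * (t + 1))) (n ^ 2) = 0 := by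
  unfold bRep
  convert Set.ncard_empty (ℤ × ℤ)
  rw [Set.eq_empty_iff_forall_notMem]
  rintro ⟨x, y⟩ h
  simp only [Set.mem_ofPred_eq, bVal] at h
  exact hn (three_dvd_of_two_mul_sq_add (c := 3 * 3 ^ (2 * t) * y ^ 2) (x := x)
    (by rw [← h]; ring)).2

theorem bRep_three_mul_sq (t : ℕ) (n : ℤ) :
    bRep 2 0 (3 ^ (2 * (t + 1))) ((3 * n) ^ 2) = bRep 2 0 (3 ^ (2 * t)) (n ^ 2) := by
  unfold bRep
  symm
  refine Set.ncard_congr (fun v _ => (3 * v.1, v.2)) ?_ ?_ ?_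
  · rintro ⟨x, y⟩ h
    simp only [Set.mem_ofPred_eq, bVal] at h ⊢
    linear_combination 9 * h
  · rintro ⟨x, y⟩ ⟨x', y'⟩ _ _ h
    simp only [Prod.mk.injEq] at h ⊢
    exact ⟨by omega, h.2⟩
  · rintro ⟨x, y⟩ h
    simp only [Set.mem_ofPred_eq, bVal] at h
    obtain ⟨⟨z, rfl⟩, -⟩ := three_dvd_of_two_mul_sq_add (c := 3 * 3 ^ (2 * t) * y ^ 2) (x := x)
      (n := 3 * n) (by rw [← h]; ring)
    refine ⟨(z, y), ?_, rfl⟩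
    simp only [Set.mem_ofPred_eq, bVal]
    have : (9 : ℤ) * (2 * z ^ 2 + 0 * z * y + 3 ^ (2 * t) * y ^ 2) = 9 * n ^ 2 := by
      linear_combination h
    linarith

theorem bRep_mul_sq (t : ℕ) {m n : ℕ} (hn : n ≠ 0) (hn6 : Nat.Coprime n 6)
    (hmn : Nat.Coprime m n) :
    (bRep 2 0 (3 ^ (2 * t)) (((m : ℤ) * n) ^ 2) : ℤ) = bRep 2 0 (3 ^ (2 * t)) ((m : ℤ) ^ 2) *
      ∏ p ∈ n.primeFactors, ∑ s ∈ range (2 * n.factorization p + 1), jacobiSym (-2) p ^ s := by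
  have hn23 : ¬ 2 ∣ n ∧ ¬ 3 ∣ n := by
    rw [← Nat.Prime.coprime_iff_not_dvd Nat.prime_two,
      ← Nat.Prime.coprime_iff_not_dvd Nat.prime_three]
    exact ⟨(hn6.coprime_dvd_right (by norm_num)).symm, (hn6.coprime_dvd_right (by norm_num)).symm⟩
  induction t generalizing m with
  | zero =>
    simp only [mul_zero, pow_zero, bRep_eq_ncard_normFiber]
    exact ncard_normFiber_mul_sq hn hn23.1 hmn
  | succ t ih =>
    by_cases h3 : 3 ∣ m
    · obtain ⟨m, rfl⟩ := h3
      push_cast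
      rw [mul_assoc, bRep_three_mul_sq, bRep_three_mul_sq]
      exact ih hmn.coprime_mul_left
    · have h3' : ¬ (3 : ℤ) ∣ m := by exact_mod_cast h3
      have h3n : ¬ (3 : ℤ) ∣ m * n := by
        exact_mod_cast fun h => (Nat.prime_three.dvd_mul.1 h).elim h3 hn23.2
      rw [bRep_sq_eq_zero_of_not_three_dvd t h3', bRep_sq_eq_zero_of_not_three_dvd t h3n]
      simp

theorem jacobiSym_neg_bDisc (t : ℕ) {p : ℕ} (hp : Nat.Coprime p 6) :
    jacobiSym (-bDisc 2 0 (3 ^ (2 * t))) p = jacobiSym (-2) p := by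
  have hdisc : -bDisc 2 0 (3 ^ (2 * t)) = -2 * (2 * 3 ^ t) ^ 2 := by
    unfold bDisc
    ring
  have hcop : Int.gcd (2 * 3 ^ t) p = 1 := by
    have h2 : Nat.Coprime 2 p := (hp.coprime_dvd_right (by norm_num)).symm
    have h3 : Nat.Coprime 3 p := (hp.coprime_dvd_right (by norm_num)).symm
    have : Nat.Coprime (2 * 3 ^ t) p := h2.mul_left (h3.pow_left t)
    exact_mod_cast this
  rw [hdisc, jacobiSym.mul_left, jacobiSym.sq_one' hcop, mul_one]

/-- For every `t ≥ 0`, the binary form `2x² + 3^{2t} y²` is strongly s-regular. -/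
theorem stmt_19 (t : ℕ) (n₁ n₂ : ℕ) (h₁ : 0 < n₁) (h₂ : 0 < n₂)
    (hfac : ∀ p : ℕ, p.Prime → p ∣ n₁ → p = 2 ∨ p = 3)
    (hcop : Nat.Coprime n₂ 6) :
    (bRep 2 0 (3 ^ (2 * t)) (((n₁ : ℤ) * (n₂ : ℤ)) ^ 2) : ℤ) =
      (bRep 2 0 (3 ^ (2 * t)) ((n₁ : ℤ) ^ 2) : ℤ) *
        ∏ p ∈ n₂.primeFactors, bHp (bDisc 2 0 (3 ^ (2 * t))) p (n₂.factorization p) := by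
  have hmn : Nat.Coprime n₁ n₂ := by
    refine Nat.coprime_of_dvd fun p hp hp1 hp2 => ?_
    have h6 : p ∣ 6 := by rcases hfac p hp hp1 with rfl | rfl <;> norm_num
    exact hp.one_lt.ne' (Nat.dvd_one.1 (hcop ▸ Nat.dvd_gcd hp2 h6))
  rw [bRep_mul_sq t h₂.ne' hcop hmn]
  congr 1
  refine prod_congr rfl fun p hp => ?_
  rw [bHp, jacobiSym_neg_bDisc t (hcop.coprime_dvd_left (Nat.dvd_of_mem_primeFactors hp))]
end
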